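/- Fix a partition λ with at most n parts and μ ∈ S_n(λ), and set d = |μ|. Then f*_μ is the unique polynomial g ∈ K[x_1,…,x_n] of total degree at most d such that: (i) g(ν̃) = 0 for every composition ν with |ν| ≤ d and ν ∉ S_n(λ); and (ii) for every τ ∈ S_n(λ), the coefficient of the monomial x^τ in g equals 1 if τ = μ and 0 otherwise. -/

import Mathlib

open MvPolynomial

noncomputable section
open scoped Classical

/-- The field `K = ℚ(q,t)`. -/
abbrev K : Type := FractionRing (MvPolynomial (Fin 2) ℚ)

/-- The indeterminate `q` as an element of `K`. -/
def qq : K := algebraMap (MvPolynomial (Fin 2) ℚ) K (X 0)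

/-- The indeterminate `t` as an element of `K`. -/
def tt : K := algebraMap (MvPolynomial (Fin 2) ℚ) K (X 1)

/-- The size `|ν|` of a composition. -/
def csize {n : ℕ} (ν : Fin n → ℕ) : ℕ := ∑ i, ν i

/-- `k_i(ν) = #{j < i : ν_j > ν_i} + #{j > i : ν_j ≥ ν_i}`. -/
def kstat {n : ℕ} (ν : Fin n → ℕ) (i : Fin n) : ℕ :=
  Set.ncard {j : Fin n | j < i ∧ ν i < ν j} + Set.ncard {j : Fin n | i < j ∧ ν i ≤ ν j}

/-- The evaluation point `ν̃ = (q^{ν_i} t^{-k_i(ν)})_i`. -/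
def evalPt {n : ℕ} (ν : Fin n → ℕ) : Fin n → K :=
  fun i => qq ^ ν i * tt ^ (-(kstat ν i : ℤ))

/-- Weakly decreasing composition. -/
def IsPartition {n : ℕ} (l : Fin n → ℕ) : Prop := ∀ i j : Fin n, i ≤ j → l j ≤ l i

/-- The action `σ·μ := μ ∘ σ⁻¹`. -/
def permAct {n : ℕ} (σ : Equiv.Perm (Fin n)) (μ : Fin n → ℕ) : Fin n → ℕ := μ ∘ ⇑σ.symm

/-- `S_n(λ)`: the rearrangements of `λ`. -/
def Sn {n : ℕ} (l : Fin n → ℕ) : Set (Fin n → ℕ) :=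
  {μ | ∃ σ : Equiv.Perm (Fin n), permAct σ l = μ}

/-- The rearrangements of `λ` as a `Finset`. -/
def SnFinset {n : ℕ} (l : Fin n → ℕ) : Finset (Fin n → ℕ) :=
  Finset.image (fun σ : Equiv.Perm (Fin n) => permAct σ l) Finset.univ

/-- The exponent `Finsupp` of the monomial `x^μ`. -/
def expOf {n : ℕ} (μ : Fin n → ℕ) : Fin n →₀ ℕ := Finsupp.equivFunOnFinite.symm μ

/-- Characterization of the interpolation nonsymmetric Macdonald polynomial `E*_μ`. -/
def IsEstar {n : ℕ} (μ : Fin n → ℕ) (f : MvPolynomial (Fin n) K) : Prop :=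
  f.totalDegree ≤ csize μ ∧ coeff (expOf μ) f = 1 ∧
    ∀ ν : Fin n → ℕ, csize ν ≤ csize μ → ν ≠ μ → eval (evalPt ν) f = 0

/-- The interpolation nonsymmetric Macdonald polynomial `E*_μ` (unique by Knop–Sahi). -/
def Estar {n : ℕ} (μ : Fin n → ℕ) : MvPolynomial (Fin n) K :=
  if h : ∃ f, IsEstar μ f then h.choose else 0

/-- Characterization of the interpolation (symmetric) Macdonald polynomial `P*_λ`. -/
def IsPstar {n : ℕ} (l : Fin n → ℕ) (f : MvPolynomial (Fin n) K) : Prop :=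
  f.IsSymmetric ∧ f.totalDegree ≤ csize l ∧ coeff (expOf l) f = 1 ∧
    ∀ ν : Fin n → ℕ, IsPartition ν → csize ν ≤ csize l → ν ≠ l → eval (evalPt ν) f = 0

/-- The interpolation Macdonald polynomial `P*_λ`. -/
def Pstar {n : ℕ} (l : Fin n → ℕ) : MvPolynomial (Fin n) K :=
  if h : ∃ f, IsPstar l f then h.choose else 0

/-- The space `V*_λ`. -/
def Vstar {n : ℕ} (l : Fin n → ℕ) : Submodule K (MvPolynomial (Fin n) K) :=
  (restrictTotalDegree (Fin n) K (csize l)) ⊓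
    ⨅ (ν : Fin n → ℕ) (_ : csize ν ≤ csize l ∧ ν ∉ Sn l),
      LinearMap.ker (aeval (R := K) (evalPt ν)).toLinearMap

/-- Exchange of the variables `x_i` and `x_j` in a polynomial. -/
def swapVars {n : ℕ} (i j : Fin n) (f : MvPolynomial (Fin n) K) : MvPolynomial (Fin n) K :=
  rename (Equiv.swap i j) f

/-- Exact division of polynomials: the unique `g` with `a = b * g` when it exists. -/
def exactDiv {n : ℕ} (a b : MvPolynomial (Fin n) K) : MvPolynomial (Fin n) K :=
  if h : ∃ g, a = b * g then h.choose else 0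

/-- The Hecke operator
`T f = t f − ((t x_i − x_j)/(x_i − x_j))·(f − s_i f)` (where `j = i+1`). -/
def hecke {n : ℕ} (i j : Fin n) (f : MvPolynomial (Fin n) K) : MvPolynomial (Fin n) K :=
  C tt * f - (C tt * X i - X j) * exactDiv (f - swapVars i j f) (X i - X j)

/-- The Coxeter length of a permutation (number of inversions). -/
def permLength {n : ℕ} (σ : Equiv.Perm (Fin n)) : ℕ :=
  Set.ncard {p : Fin n × Fin n | p.1 < p.2 ∧ σ p.2 < σ p.1}

/-- The adjacent transposition `s_i = (i, i+1)` (0-indexed). -/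
def adjSwap {n : ℕ} (i : {i : ℕ // i + 1 < n}) : Equiv.Perm (Fin n) :=
  Equiv.swap ⟨i.1, Nat.lt_of_succ_lt i.2⟩ ⟨i.1 + 1, i.2⟩

/-- The Hecke operator `T_i` for an adjacent transposition index. -/
def heckeAt {n : ℕ} (i : {i : ℕ // i + 1 < n}) :
    MvPolynomial (Fin n) K → MvPolynomial (Fin n) K :=
  hecke ⟨i.1, Nat.lt_of_succ_lt i.2⟩ ⟨i.1 + 1, i.2⟩

/-- `T_{i_1} ⋯ T_{i_ℓ} f` for a word `w = [i_1, …, i_ℓ]`. -/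
def Tword {n : ℕ} (w : List {i : ℕ // i + 1 < n}) (f : MvPolynomial (Fin n) K) :
    MvPolynomial (Fin n) K :=
  w.foldr heckeAt f

/-- `w` is a reduced word for `σ`. -/
def IsReducedWordOf {n : ℕ} (w : List {i : ℕ // i + 1 < n}) (σ : Equiv.Perm (Fin n)) : Prop :=
  (w.map adjSwap).prod = σ ∧ w.length = permLength σ

/-- `T_σ`, computed from a reduced word of `σ` (independent of the choice, by the
Hecke algebra relations). -/
def Tsigma {n : ℕ} (σ : Equiv.Perm (Fin n)) :
    MvPolynomial (Fin n) K → MvPolynomial (Fin n) K :=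
  if h : ∃ w, IsReducedWordOf w σ then Tword h.choose else id

/-- `σ_μ`: the (unique) shortest permutation with `σ·l = μ`. -/
def sigmaMin {n : ℕ} (l μ : Fin n → ℕ) : Equiv.Perm (Fin n) :=
  if h : ∃ σ, permAct σ l = μ ∧ ∀ τ, permAct τ l = μ → permLength σ ≤ permLength τ then
    h.choose else 1

/-- The weakly decreasing rearrangement of a composition. -/
def sortDesc {n : ℕ} (μ : Fin n → ℕ) : Fin n → ℕ :=
  if h : ∃ l, IsPartition l ∧ μ ∈ Sn l then h.choose else μ

/-- The interpolation ASEP polynomial `f*_μ = T_{σ_μ} E*_λ`, where `λ` is the weakly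
decreasing rearrangement of `μ`. -/
def fstar {n : ℕ} (μ : Fin n → ℕ) : MvPolynomial (Fin n) K :=
  Tsigma (sigmaMin (sortDesc μ) μ) (Estar (sortDesc μ))

/-- The composition with entries `i` and `j` exchanged. -/
def swapEntries {n : ℕ} (i j : Fin n) (μ : Fin n → ℕ) : Fin n → ℕ := μ ∘ ⇑(Equiv.swap i j)


abbrev lo {n : ℕ} (i : {i : ℕ // i + 1 < n}) : Fin n := ⟨i.1, Nat.lt_of_succ_lt i.2⟩
abbrev hi {n : ℕ} (i : {i : ℕ // i + 1 < n}) : Fin n := ⟨i.1 + 1, i.2⟩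

lemma lo_ne_hi {n : ℕ} (i : {i : ℕ // i + 1 < n}) : lo i ≠ hi i := by
  simp [lo, hi, Fin.ext_iff]

lemma sum_split {n : ℕ} (i : {i : ℕ // i + 1 < n}) (g : Fin n → ℕ) :
    ∑ k, g k = g (lo i) + g (hi i) + ∑ k ∈ (Finset.univ.erase (lo i)).erase (hi i), g k := by
  rw [← Finset.add_sum_erase Finset.univ g (Finset.mem_univ (lo i)),
    ← Finset.add_sum_erase (Finset.univ.erase (lo i)) g
      (Finset.mem_erase.2 ⟨(lo_ne_hi i).symm, Finset.mem_univ (hi i)⟩), add_assoc]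

/-- The statistics defining the triangularity order on compositions. -/
def NN {n : ℕ} (m r : ℕ) (ρ : Fin n → ℕ) : ℕ :=
  ∑ k : Fin n, (ρ k + (if r ≤ k.val then 1 else 0) - m)

/-- The triangularity (affine Bruhat type) order on compositions. -/
def CLe {n : ℕ} (ρ μ : Fin n → ℕ) : Prop :=
  csize ρ = csize μ ∧ ∀ m r, NN m r ρ ≤ NN m r μ

lemma CLe.refl {n : ℕ} (ρ : Fin n → ℕ) : CLe ρ ρ := ⟨rfl, fun _ _ => le_rfl⟩

lemma CLe.trans {n : ℕ} {ρ μ κ : Fin n → ℕ} (h : CLe ρ μ) (h' : CLe μ κ) : CLe ρ κ :=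
  ⟨h.1.trans h'.1, fun m r => (h.2 m r).trans (h'.2 m r)⟩

lemma NN_diff {n : ℕ} (m : ℕ) (k : Fin n) (ρ : Fin n → ℕ) :
    NN m k.val ρ = NN m (k.val + 1) ρ + (if m ≤ ρ k then 1 else 0) := by
  unfold NN
  rw [← Finset.add_sum_erase Finset.univ _ (Finset.mem_univ k),
    ← Finset.add_sum_erase Finset.univ (fun j : Fin n => ρ j + (if k.val + 1 ≤ j.val then 1 else 0) - m)
      (Finset.mem_univ k)]
  have : ∑ x ∈ Finset.univ.erase k, (ρ x + (if k.val ≤ x.val then 1 else 0) - m)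
      = ∑ x ∈ Finset.univ.erase k, (ρ x + (if k.val + 1 ≤ x.val then 1 else 0) - m) := by
    apply Finset.sum_congr rfl
    intro x hx
    have hx' : x.val ≠ k.val := fun h => (Finset.mem_erase.1 hx).1 (Fin.ext h)
    split_ifs <;> omega
  rw [this]
  simp only [le_refl, if_true, Nat.succ_le_iff, lt_irrefl, if_false]
  split_ifs <;> omega

lemma NN_inj {n : ℕ} {ρ μ : Fin n → ℕ} (h : ∀ m r, NN m r ρ = NN m r μ) : ρ = μ := by
  funext k
  have key : ∀ m, m ≤ ρ k ↔ m ≤ μ k := by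
    intro m
    have h1 := NN_diff m k ρ
    have h2 := NN_diff m k μ
    rw [h, h] at h1
    split_ifs at h1 h2 <;> first | tauto | omega
  exact le_antisymm ((key _).1 le_rfl) ((key _).2 le_rfl)

lemma CLe.antisymm {n : ℕ} {ρ μ : Fin n → ℕ} (h : CLe ρ μ) (h' : CLe μ ρ) : ρ = μ :=
  NN_inj fun m r => le_antisymm (h.2 m r) (h'.2 m r)

/-- Swap of two adjacent entries. -/
def sw {n : ℕ} (i : {i : ℕ // i + 1 < n}) (ρ : Fin n → ℕ) : Fin n → ℕ := ρ ∘ ⇑(adjSwap i)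

@[simp] lemma adjSwap_lo {n : ℕ} (i : {i : ℕ // i + 1 < n}) : adjSwap i (lo i) = hi i := by
  simp [adjSwap, lo, hi]
@[simp] lemma adjSwap_hi {n : ℕ} (i : {i : ℕ // i + 1 < n}) : adjSwap i (hi i) = lo i := by
  simp [adjSwap, lo, hi]
lemma adjSwap_ne {n : ℕ} (i : {i : ℕ // i + 1 < n}) (k : Fin n) (h1 : k ≠ lo i) (h2 : k ≠ hi i) :
    adjSwap i k = k := by
  simp only [adjSwap]; exact Equiv.swap_apply_of_ne_of_ne h1 h2
@[simp] lemma adjSwap_adjSwap {n : ℕ} (i : {i : ℕ // i + 1 < n}) (k : Fin n) :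
    adjSwap i (adjSwap i k) = k := by
  simp [adjSwap]

@[simp] lemma sw_lo {n : ℕ} (i : {i : ℕ // i + 1 < n}) (ρ : Fin n → ℕ) :
    sw i ρ (lo i) = ρ (hi i) := by simp only [sw, Function.comp, adjSwap_lo]
@[simp] lemma sw_hi {n : ℕ} (i : {i : ℕ // i + 1 < n}) (ρ : Fin n → ℕ) :
    sw i ρ (hi i) = ρ (lo i) := by simp only [sw, Function.comp, adjSwap_hi]
lemma sw_ne {n : ℕ} (i : {i : ℕ // i + 1 < n}) (ρ : Fin n → ℕ) (k : Fin n) (h1 : k ≠ lo i)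
    (h2 : k ≠ hi i) : sw i ρ k = ρ k := by
  simp only [sw, Function.comp, adjSwap_ne i k h1 h2]
@[simp] lemma sw_sw {n : ℕ} (i : {i : ℕ // i + 1 < n}) (ρ : Fin n → ℕ) : sw i (sw i ρ) = ρ := by
  funext k; simp only [sw, Function.comp, adjSwap_adjSwap]

lemma csize_comp {n : ℕ} (σ : Equiv.Perm (Fin n)) (ρ : Fin n → ℕ) : csize (ρ ∘ ⇑σ) = csize ρ := by
  unfold csize; exact Equiv.sum_comp σ ρ

@[simp] lemma csize_sw {n : ℕ} (i : {i : ℕ // i + 1 < n}) (ρ : Fin n → ℕ) :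
    csize (sw i ρ) = csize ρ := csize_comp _ _

/-- `τ` lies on the `i`-string of `ρ`. -/
def InStr {n : ℕ} (i : {i : ℕ // i + 1 < n}) (ρ τ : Fin n → ℕ) : Prop :=
  (∀ k, k ≠ lo i → k ≠ hi i → τ k = ρ k) ∧ τ (lo i) + τ (hi i) = ρ (lo i) + ρ (hi i) ∧
    min (ρ (lo i)) (ρ (hi i)) ≤ τ (lo i) ∧ τ (lo i) ≤ max (ρ (lo i)) (ρ (hi i))

lemma InStr.csize {n : ℕ} {i : {i : ℕ // i + 1 < n}} {ρ τ : Fin n → ℕ} (h : InStr i ρ τ) :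
    csize τ = csize ρ := by
  unfold _root_.csize
  rw [sum_split i, sum_split i, h.2.1]
  congr 1
  apply Finset.sum_congr rfl
  intro k hk
  simp only [Finset.mem_erase, Finset.mem_univ, and_true] at hk
  exact h.1 k hk.2 hk.1

lemma ext_sw {n : ℕ} (i : {i : ℕ // i + 1 < n}) {ρ τ : Fin n → ℕ}
    (h : ∀ k, k ≠ lo i → k ≠ hi i → τ k = ρ k) (h1 : τ (lo i) = ρ (lo i))
    (h2 : τ (hi i) = ρ (hi i)) : τ = ρ := by
  funext k
  by_cases h3 : k = lo i
  · rw [h3, h1]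
  by_cases h4 : k = hi i
  · rw [h4, h2]
  exact h k h3 h4

/-- the remaining part of `NN`. -/
def NR {n : ℕ} (i : {i : ℕ // i + 1 < n}) (m r : ℕ) (ρ : Fin n → ℕ) : ℕ :=
  ∑ k ∈ (Finset.univ.erase (lo i)).erase (hi i), (ρ k + (if r ≤ k.val then 1 else 0) - m)

lemma NN_split {n : ℕ} (i : {i : ℕ // i + 1 < n}) (m r : ℕ) (ρ : Fin n → ℕ) :
    NN m r ρ = (ρ (lo i) + (if r ≤ i.1 then 1 else 0) - m) +
      (ρ (hi i) + (if r ≤ i.1 + 1 then 1 else 0) - m) + NR i m r ρ := by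
  unfold NN NR
  rw [sum_split i]

lemma NR_congr {n : ℕ} (i : {i : ℕ // i + 1 < n}) (m r : ℕ) {ρ τ : Fin n → ℕ}
    (h : ∀ k, k ≠ lo i → k ≠ hi i → τ k = ρ k) : NR i m r τ = NR i m r ρ := by
  apply Finset.sum_congr rfl
  intro k hk
  simp only [Finset.mem_erase, Finset.mem_univ, and_true] at hk
  rw [h k hk.2 hk.1]

lemma NR_r {n : ℕ} (i : {i : ℕ // i + 1 < n}) (m r : ℕ) (hr : r = i.1 ∨ r = i.1 + 2)
    (τ : Fin n → ℕ) : NR i m r τ = NR i m (i.1 + 1) τ := by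
  apply Finset.sum_congr rfl
  intro k hk
  simp only [Finset.mem_erase, Finset.mem_univ, and_true] at hk
  have h1 : k.val ≠ i.1 := fun h => hk.2 (Fin.ext h)
  have h2 : k.val ≠ i.1 + 1 := fun h => hk.1 (Fin.ext h)
  split_ifs <;> omega

lemma InStr.NN_le {n : ℕ} {i : {i : ℕ // i + 1 < n}} {ρ τ : Fin n → ℕ} (h : InStr i ρ τ)
    (m r : ℕ) (hr : r ≠ i.1 + 1) : NN m r τ ≤ NN m r ρ := by
  rw [NN_split i, NN_split i m r ρ, NR_congr i m r h.1]
  obtain ⟨-, h2, h3, h4⟩ := h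
  have : (r ≤ i.1 + 1) ↔ (r ≤ i.1) := by omega
  simp only [this]
  generalize (if r ≤ i.1 then 1 else 0) = e
  omega

lemma NN_sw {n : ℕ} (i : {i : ℕ // i + 1 < n}) (ρ : Fin n → ℕ) 
    (m r : ℕ) (hr : r ≠ i.1 + 1) : NN m r (sw i ρ) = NN m r ρ := by
  rw [NN_split i, NN_split i m r ρ, NR_congr i m r (sw_ne i ρ), sw_lo, sw_hi]
  have : (r ≤ i.1 + 1) ↔ (r ≤ i.1) := by omega
  simp only [this]
  omega

lemma InStr.cle {n : ℕ} {i : {i : ℕ // i + 1 < n}} {ρ τ μ : Fin n → ℕ} (h : InStr i ρ τ)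
    (hle : CLe ρ μ) (hμ : μ (hi i) ≤ μ (lo i)) : CLe τ (sw i μ) := by
  refine ⟨by rw [h.csize, csize_sw, hle.1], fun m r => ?_⟩
  by_cases hr : r = i.1 + 1
  · subst hr
    have hA := (h.NN_le m (i.1 + 2) (by omega)).trans (hle.2 m (i.1 + 2))
    have hC := (h.NN_le m i.1 (by omega)).trans (hle.2 m i.1)
    rw [NN_split i, NN_split i m _ μ, NR_r i m _ (Or.inr rfl) τ, NR_r i m _ (Or.inr rfl) μ] at hA
    rw [NN_split i, NN_split i m _ μ, NR_r i m _ (Or.inl rfl) τ, NR_r i m _ (Or.inl rfl) μ] at hC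
    rw [NN_split i, NN_split i m _ (sw i μ), NR_congr i m _ (sw_ne i μ), sw_lo, sw_hi]
    simp only [le_refl, if_true, if_false,
      show ¬ (i.1 + 2 ≤ i.1) by omega, show ¬ (i.1 + 2 ≤ i.1 + 1) by omega,
      show ¬ (i.1 + 1 ≤ i.1) by omega, show (i.1 ≤ i.1 + 1) by omega] at hA hC ⊢
    omega
  · rw [NN_sw i μ m r hr]
    exact (h.NN_le m r hr).trans (hle.2 m r)

lemma InStr.self {n : ℕ} (i : {i : ℕ // i + 1 < n}) (ρ : Fin n → ℕ) : InStr i ρ ρ :=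
  ⟨fun _ _ _ => rfl, rfl, by omega, by omega⟩

lemma not_cle_sw {n : ℕ} {i : {i : ℕ // i + 1 < n}} {μ : Fin n → ℕ}
    (hμ : μ (hi i) < μ (lo i)) : ¬ CLe (sw i μ) μ := by
  intro h
  have := h.2 (μ (lo i)) (i.1 + 1)
  rw [NN_split i, NN_split i _ _ μ, NR_congr i _ _ (sw_ne i μ), sw_lo, sw_hi] at this
  simp only [le_refl, if_true, show ¬ (i.1 + 1 ≤ i.1) by omega, if_false] at this
  omega

/-- A string element which is not dominated is one of the two ends. -/
lemma InStr.eq_or {n : ℕ} {i : {i : ℕ // i + 1 < n}} {ρ τ : Fin n → ℕ} (h : InStr i ρ τ)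
    (hle : ∀ m, NN m n ρ ≤ NN m n τ) : τ = ρ ∨ τ = sw i ρ := by
  have := hle (max (τ (lo i)) (τ (hi i)))
  have hi2 := i.2
  rw [NN_split i, NN_split i _ _ τ, NR_congr i _ _ h.1] at this
  simp only [show ¬ (n ≤ i.1) by omega, show ¬ (n ≤ i.1 + 1) by omega, if_false] at this
  obtain ⟨h1, h2, h3, h4⟩ := h
  have : (τ (lo i) = ρ (lo i) ∧ τ (hi i) = ρ (hi i)) ∨ (τ (lo i) = ρ (hi i) ∧ τ (hi i) = ρ (lo i)) := by
    omega
  rcases this with h | h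
  · left; exact ext_sw i h1 h.1 h.2
  · right
    apply ext_sw i
    · intro k hk hk'; rw [sw_ne i ρ k hk hk', h1 k hk hk']
    · rw [sw_lo, h.1]
    · rw [sw_hi, h.2]

lemma NN_n_comp {n : ℕ} (σ : Equiv.Perm (Fin n)) (ρ : Fin n → ℕ) (m : ℕ) :
    NN m n (ρ ∘ ⇑σ) = NN m n ρ := by
  unfold NN
  rw [← Equiv.sum_comp σ (fun k : Fin n => ρ k + (if n ≤ k.val then 1 else 0) - m)]
  apply Finset.sum_congr rfl
  intro k _
  have h1 := k.2
  have h2 := (σ k).2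
  simp only [Function.comp, show ¬ (n ≤ k.val) by omega, show ¬ (n ≤ (σ k).val) by omega, if_false]

/-- The affine raising operation `(ν_1,…,ν_n) ↦ (ν_n+1, ν_1,…,ν_{n-1})`. -/
def PhiC {m : ℕ} (ρ : Fin (m + 1) → ℕ) : Fin (m + 1) → ℕ :=
  Fin.cons (ρ (Fin.last m) + 1) (fun i : Fin m => ρ i.castSucc)

lemma csize_PhiC {m : ℕ} (ρ : Fin (m + 1) → ℕ) : csize (PhiC ρ) = csize ρ + 1 := by
  unfold csize PhiC
  rw [Fin.sum_univ_succ, Fin.sum_univ_castSucc]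
  simp only [Fin.cons_zero, Fin.cons_succ]
  omega

lemma NN_PhiC {N : ℕ} (ρ : Fin (N + 1) → ℕ) (m r : ℕ) (hr : r ≤ N) :
    NN m (r + 1) (PhiC ρ) = NN m r ρ := by
  unfold NN PhiC
  rw [Fin.sum_univ_succ, Fin.sum_univ_castSucc]
  simp only [Fin.cons_zero, Fin.cons_succ, Fin.val_zero, Fin.val_succ, Fin.val_castSucc,
    Fin.val_last, hr, if_true, Nat.add_le_add_iff_right, show ¬ (r + 1 ≤ 0) by omega, if_false]
  omega

lemma NN_big {n : ℕ} (ρ : Fin n → ℕ) (m r : ℕ) (hr : n ≤ r) : NN m r ρ = NN m n ρ := by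
  unfold NN
  apply Finset.sum_congr rfl
  intro k _
  have := k.2
  simp only [show ¬ (n ≤ k.val) by omega, show ¬ (r ≤ k.val) by omega]

lemma NN_zero_succ {n : ℕ} (ρ : Fin n → ℕ) (m : ℕ) : NN (m + 1) 0 ρ = NN m n ρ := by
  unfold NN
  apply Finset.sum_congr rfl
  intro k _
  have := k.2
  simp only [show ¬ (n ≤ k.val) by omega, Nat.zero_le, if_true, if_false]
  omega

lemma NN_zero_zero {n : ℕ} (ρ : Fin n → ℕ) : NN 0 0 ρ = csize ρ + n := by
  simp [NN, csize, Finset.sum_add_distrib]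

lemma CLe.PhiC {N : ℕ} {ρ μ : Fin (N + 1) → ℕ} (h : CLe ρ μ) : CLe (PhiC ρ) (PhiC μ) := by
  have key : ∀ m r, NN m (r + 1) (_root_.PhiC ρ) ≤ NN m (r + 1) (_root_.PhiC μ) := by
    intro m r
    by_cases hr : r ≤ N
    · rw [NN_PhiC _ _ _ hr, NN_PhiC _ _ _ hr]; exact h.2 m r
    · rw [NN_big _ _ _ (by omega), NN_big (_root_.PhiC μ) _ _ (by omega), NN_PhiC _ _ _ le_rfl,
        NN_PhiC _ _ _ le_rfl]
      exact h.2 m N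
  refine ⟨by rw [csize_PhiC, csize_PhiC, h.1], fun m r => ?_⟩
  cases r with
  | succ r => exact key m r
  | zero =>
    cases m with
    | zero => rw [NN_zero_zero, NN_zero_zero, csize_PhiC, csize_PhiC, h.1]
    | succ m => rw [NN_zero_succ, NN_zero_succ]; exact key m N


/-- Set of ascents pairs. -/
def invSet {n : ℕ} (κ : Fin n → ℕ) : Set (Fin n × Fin n) := {p | p.1 < p.2 ∧ κ p.1 < κ p.2}

def inv {n : ℕ} (κ : Fin n → ℕ) : ℕ := (invSet κ).ncard

lemma adjSwap_lt {n : ℕ} (i : {i : ℕ // i + 1 < n}) {a b : Fin n} (h : a < b)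
    (hne : ¬ (a = lo i ∧ b = hi i)) : adjSwap i a < adjSwap i b := by
  simp only [adjSwap, Equiv.swap_apply_def]
  simp only [lo, hi, Fin.ext_iff, Fin.lt_def] at *
  split_ifs <;> (try simp only) <;> omega

lemma inv_sw_aux {n : ℕ} (i : {i : ℕ // i + 1 < n}) (κ : Fin n → ℕ) :
    (invSet (sw i κ) \ {(lo i, hi i)}).ncard = (invSet κ \ {(lo i, hi i)}).ncard := by
  have key : ∀ (κ : Fin n → ℕ) (a b : Fin n), (a, b) ∈ invSet (sw i κ) \ {(lo i, hi i)} →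
      (adjSwap i a, adjSwap i b) ∈ invSet κ \ {(lo i, hi i)} := by
    rintro κ a b ⟨⟨h1, h2⟩, h3⟩
    simp only [Set.mem_singleton_iff, Prod.mk.injEq] at h1 h2 h3
    refine ⟨⟨adjSwap_lt i h1 h3, h2⟩, ?_⟩
    simp only [Set.mem_singleton_iff, Prod.mk.injEq]
    rintro ⟨h4, h5⟩
    have ha : a = hi i := by rw [← adjSwap_adjSwap i a, h4, adjSwap_lo]
    have hb : b = lo i := by rw [← adjSwap_adjSwap i b, h5, adjSwap_hi]
    subst ha hb
    simp only [lo, hi, Fin.lt_def] at h1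
    omega
  apply Set.ncard_congr (fun p _ => (adjSwap i p.1, adjSwap i p.2))
  · rintro ⟨a, b⟩ h; exact key κ a b h
  · rintro ⟨a, b⟩ ⟨c, d⟩ _ _ h
    simpa using h
  · rintro ⟨a, b⟩ h
    refine ⟨(adjSwap i a, adjSwap i b), key _ a b (by rw [sw_sw]; exact h), by simp⟩

lemma ncard_diff_if {α : Type*} (s : Set α) (hs : s.Finite) (p : α) :
    s.ncard = (s \ {p}).ncard + if p ∈ s then 1 else 0 := by
  split_ifs with h
  · exact (Set.ncard_sdiff_singleton_add_one h hs).symm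
  · rw [Set.sdiff_singleton_eq_self h, add_zero]

lemma inv_sw {n : ℕ} (i : {i : ℕ // i + 1 < n}) (κ : Fin n → ℕ) :
    inv (sw i κ) + (if κ (lo i) < κ (hi i) then 1 else 0) =
      inv κ + (if κ (hi i) < κ (lo i) then 1 else 0) := by
  unfold inv
  have hlt : lo i < hi i := by simp [lo, hi, Fin.lt_def]
  rw [ncard_diff_if (invSet κ) (Set.toFinite _) (lo i, hi i),
    ncard_diff_if (invSet (sw i κ)) (Set.toFinite _) (lo i, hi i), inv_sw_aux]
  have h1 : ((lo i, hi i) ∈ invSet κ) ↔ κ (lo i) < κ (hi i) := by simp [invSet]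
  have h2 : ((lo i, hi i) ∈ invSet (sw i κ)) ↔ κ (hi i) < κ (lo i) := by
    simp only [invSet, Set.mem_ofPred_eq, sw_lo, sw_hi, hlt, true_and]
  simp only [h1, h2]
  omega

lemma inv_partition {n : ℕ} {l : Fin n → ℕ} (hl : IsPartition l) : inv l = 0 := by
  unfold inv
  convert Set.ncard_empty (Fin n × Fin n)
  ext ⟨a, b⟩
  simp only [invSet, Set.mem_ofPred_eq, Set.mem_empty_iff_false, iff_false, not_and, not_lt]
  intro h
  exact hl a b h.le

lemma exists_ascent {n : ℕ} {μ : Fin n → ℕ} (h : ¬ IsPartition μ) :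
    ∃ i : {i : ℕ // i + 1 < n}, μ (lo i) < μ (hi i) := by
  by_contra! hc
  apply h
  have key : ∀ (d a : ℕ) (h : a + d < n), μ ⟨a + d, h⟩ ≤ μ ⟨a, by omega⟩ := by
    intro d
    induction d with
    | zero => intro a h; exact le_rfl
    | succ d ih =>
      intro a h
      exact (hc ⟨a + d, h⟩).trans (ih a (by omega))
  intro i j hij
  have := key (j.val - i.val) i.val (by have := j.2; have : i.val ≤ j.val := hij; omega)
  have e : (⟨i.val + (j.val - i.val), by have := j.2; have : i.val ≤ j.val := hij; omega⟩ : Fin n) = j := by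
    apply Fin.ext; have : i.val ≤ j.val := hij; simp only; omega
  rw [e] at this
  exact this

lemma permAct_mul {n : ℕ} (σ τ : Equiv.Perm (Fin n)) (l : Fin n → ℕ) :
    permAct (σ * τ) l = permAct σ (permAct τ l) := rfl

lemma permAct_adj {n : ℕ} (i : {i : ℕ // i + 1 < n}) (l : Fin n → ℕ) :
    permAct (adjSwap i) l = sw i l := by
  simp only [permAct, sw, adjSwap, Equiv.symm_swap]

lemma mem_Sn_self {n : ℕ} (l : Fin n → ℕ) : l ∈ Sn l := ⟨1, rfl⟩

lemma permAct_mem_Sn {n : ℕ} {l μ : Fin n → ℕ} (σ : Equiv.Perm (Fin n)) (h : μ ∈ Sn l) :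
    permAct σ μ ∈ Sn l := by
  obtain ⟨τ, rfl⟩ := h
  exact ⟨σ * τ, rfl⟩

lemma sw_mem_Sn {n : ℕ} {l μ : Fin n → ℕ} (i : {i : ℕ // i + 1 < n}) :
    sw i μ ∈ Sn l ↔ μ ∈ Sn l := by
  constructor
  · intro h
    have := permAct_mem_Sn (adjSwap i) h
    rwa [permAct_adj, sw_sw] at this
  · intro h
    have := permAct_mem_Sn (adjSwap i) h
    rwa [permAct_adj] at this

lemma Sn_symm {n : ℕ} {l μ : Fin n → ℕ} (h : μ ∈ Sn l) : l ∈ Sn μ := by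
  obtain ⟨τ, rfl⟩ := h
  exact ⟨τ⁻¹, by rw [← permAct_mul]; simp [permAct]; rfl⟩

lemma Sn_trans {n : ℕ} {l μ κ : Fin n → ℕ} (h : μ ∈ Sn l) (h' : κ ∈ Sn μ) : κ ∈ Sn l := by
  obtain ⟨τ, rfl⟩ := h'
  exact permAct_mem_Sn τ h

lemma Sn_eq {n : ℕ} {l μ : Fin n → ℕ} (h : μ ∈ Sn l) : Sn μ = Sn l :=
  Set.ext fun _ => ⟨fun h' => Sn_trans h h', fun h' => Sn_trans (Sn_symm h) h'⟩

lemma csize_Sn {n : ℕ} {l μ : Fin n → ℕ} (h : μ ∈ Sn l) : csize μ = csize l := by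
  obtain ⟨τ, rfl⟩ := h
  exact csize_comp _ _

lemma NN_Sn {n : ℕ} {l μ : Fin n → ℕ} (h : μ ∈ Sn l) (m : ℕ) : NN m n μ = NN m n l := by
  obtain ⟨τ, rfl⟩ := h
  exact NN_n_comp _ _ _

lemma partition_unique {n : ℕ} {l μ : Fin n → ℕ} (hl : IsPartition l) (hμ : IsPartition μ)
    (h : μ ∈ Sn l) : μ = l := by
  obtain ⟨σ, rfl⟩ := h
  have h1 : Monotone ((fun i => OrderDual.toDual (l i)) ∘ ⇑σ.symm) := fun i j hij => hμ i j hij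
  have h2 : Monotone ((fun i => OrderDual.toDual (l i)) ∘ ⇑(1 : Equiv.Perm (Fin n))) :=
    fun i j hij => hl i j hij
  have := Tuple.unique_monotone h1 h2
  funext k
  exact congrFun this k

lemma orbit_induct {n : ℕ} {l : Fin n → ℕ} (hl : IsPartition l) (P : (Fin n → ℕ) → Prop)
    (h0 : P l) (hs : ∀ κ (i : {i : ℕ // i + 1 < n}), κ ∈ Sn l → κ (hi i) < κ (lo i) → P κ → P (sw i κ)) :
    ∀ μ ∈ Sn l, P μ := by
  have key : ∀ (N : ℕ) μ, inv μ = N → μ ∈ Sn l → P μ := by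
    intro N
    induction N using Nat.strong_induction_on with
    | _ N ih =>
      intro μ hN hμ
      by_cases hp : IsPartition μ
      · rw [partition_unique hl hp hμ]; exact h0
      · obtain ⟨i, hi'⟩ := exists_ascent hp
        have h1 := inv_sw i μ
        rw [if_pos hi', if_neg (by omega)] at h1
        have h2 := ih (inv (sw i μ)) (by omega) (sw i μ) rfl ((sw_mem_Sn i).2 hμ)
        have h3 := hs (sw i μ) i ((sw_mem_Sn i).2 hμ) (by rw [sw_lo, sw_hi]; exact hi') h2
        rwa [sw_sw] at h3
  exact fun μ hμ => key _ μ rfl hμ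

lemma partition_cle {n : ℕ} {l : Fin n → ℕ} (hl : IsPartition l) : ∀ μ ∈ Sn l, CLe l μ := by
  apply orbit_induct hl
  · exact CLe.refl l
  · intro κ i _ h1 h2
    exact h2.trans ((InStr.self i κ).cle (CLe.refl κ) h1.le)

/-- action of a word on compositions -/
def act {n : ℕ} (w : List {i : ℕ // i + 1 < n}) (l : Fin n → ℕ) : Fin n → ℕ := w.foldr sw l

lemma permAct_prod {n : ℕ} (w : List {i : ℕ // i + 1 < n}) (l : Fin n → ℕ) :
    permAct (w.map adjSwap).prod l = act w l := by
  induction w with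
  | nil => rfl
  | cons i w ih =>
    rw [List.map_cons, List.prod_cons, permAct_mul, ih, permAct_adj]; rfl

lemma inv_act_le {n : ℕ} {l : Fin n → ℕ} (hl : IsPartition l) (w : List {i : ℕ // i + 1 < n}) :
    inv (act w l) ≤ w.length := by
  induction w with
  | nil => simp [act, inv_partition hl]
  | cons i w ih =>
    have := inv_sw i (act w l)
    have e : act (i :: w) l = sw i (act w l) := rfl
    rw [e, List.length_cons]
    split_ifs at this <;> omega

lemma exists_word {n : ℕ} {l : Fin n → ℕ} (hl : IsPartition l) :
    ∀ μ ∈ Sn l, ∃ w, act w l = μ ∧ w.length = inv μ := by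
  apply orbit_induct hl
  · exact ⟨[], rfl, by rw [inv_partition hl]; rfl⟩
  · rintro κ i _ h1 ⟨w, rfl, h2⟩
    refine ⟨i :: w, rfl, ?_⟩
    have := inv_sw i (act w l)
    rw [if_pos h1, if_neg (by omega)] at this
    rw [List.length_cons]
    omega

lemma word_induct {n : ℕ} {l : Fin n → ℕ} (hl : IsPartition l)
    (Q : (Fin n → ℕ) → MvPolynomial (Fin n) K → Prop) (f : MvPolynomial (Fin n) K) (h0 : Q l f)
    (hs : ∀ κ f (i : {i : ℕ // i + 1 < n}), κ ∈ Sn l → κ (hi i) < κ (lo i) → Q κ f →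
      Q (sw i κ) (heckeAt i f)) (w : List {i : ℕ // i + 1 < n}) (hw : w.length ≤ inv (act w l)) :
    Q (act w l) (Tword w f) := by
  induction w with
  | nil => exact h0
  | cons i w ih =>
    have h1 := inv_sw i (act w l)
    have h2 := inv_act_le hl w
    have e : act (i :: w) l = sw i (act w l) := rfl
    rw [e, List.length_cons] at hw
    have h3 : act w l (hi i) < act w l (lo i) := by
      by_contra hc
      rw [if_neg hc] at h1
      omega
    refine hs _ _ i ?_ h3 (ih ?_)
    · exact ⟨(w.map adjSwap).prod, permAct_prod w l⟩
    · rw [if_pos h3, if_neg (by omega)] at h1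
      omega

/-- the staircase -/
def rv (n : ℕ) : Fin n → ℕ := fun i => n - 1 - i.val

lemma rv_partition (n : ℕ) : IsPartition (rv n) := by
  intro i j h
  have : i.val ≤ j.val := h
  simp only [rv]; omega

lemma permLength_eq {n : ℕ} (σ : Equiv.Perm (Fin n)) : permLength σ = inv (permAct σ (rv n)) := by
  unfold permLength inv
  apply Set.ncard_congr (fun p _ => (σ p.2, σ p.1))
  · rintro ⟨a, b⟩ ⟨h1, h2⟩
    refine ⟨h2, ?_⟩
    simp only [permAct, Function.comp, Equiv.symm_apply_apply, rv]
    have h1 : a.val < b.val := h1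
    have := b.2
    omega
  · rintro ⟨a, b⟩ ⟨c, d⟩ _ _ h
    simp only [Prod.mk.injEq, EmbeddingLike.apply_eq_iff_eq] at h
    simp [h.1, h.2]
  · rintro ⟨a, b⟩ ⟨h1, h2⟩
    refine ⟨(σ.symm b, σ.symm a), ⟨?_, by simpa using h1⟩, by simp⟩
    simp only [permAct, Function.comp, rv] at h2
    rw [Fin.lt_def]
    simp only at h2 ⊢
    have := (σ.symm b).2
    have := (σ.symm a).2
    omega

lemma permAct_rv_inj {n : ℕ} {σ τ : Equiv.Perm (Fin n)} (h : permAct σ (rv n) = permAct τ (rv n)) :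
    σ = τ := by
  have : σ.symm = τ.symm := by
    ext k
    have := congrFun h k
    simp only [permAct, Function.comp, rv] at this
    have := (σ.symm k).2
    have := (τ.symm k).2
    omega
  exact Equiv.symm_bijective.1 this

lemma exists_reduced {n : ℕ} (σ : Equiv.Perm (Fin n)) : ∃ w, IsReducedWordOf w σ := by
  obtain ⟨w, h1, h2⟩ := exists_word (rv_partition n) (permAct σ (rv n)) ⟨σ, rfl⟩
  refine ⟨w, permAct_rv_inj ?_, by rw [h2, permLength_eq]⟩
  rw [permAct_prod, h1]

lemma Tsigma_spec {n : ℕ} {l μ : Fin n → ℕ} (hl : IsPartition l) (hμ : μ ∈ Sn l) :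
    ∃ w, Tsigma (sigmaMin l μ) = Tword w ∧ act w l = μ ∧ w.length ≤ inv μ := by
  have hex : ∃ σ, permAct σ l = μ ∧ ∀ τ, permAct τ l = μ → permLength σ ≤ permLength τ := by
    have hne : {σ : Equiv.Perm (Fin n) | permAct σ l = μ}.Nonempty := hμ
    obtain ⟨σ, h1, h2⟩ := Set.exists_min_image _ permLength (Set.toFinite _) hne
    exact ⟨σ, h1, fun τ hτ => h2 τ hτ⟩
  have hσ := hex.choose_spec
  have e : sigmaMin l μ = hex.choose := dif_pos hex
  rw [← e] at hσ
  have hred := exists_reduced (sigmaMin l μ)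
  have e2 : Tsigma (sigmaMin l μ) = Tword hred.choose := dif_pos hred
  obtain ⟨h3, h4⟩ := hred.choose_spec
  refine ⟨hred.choose, e2, ?_, ?_⟩
  · rw [← permAct_prod, h3, hσ.1]
  · rw [h4]
    obtain ⟨w, h5, h6⟩ := exists_word hl μ hμ
    refine (hσ.2 (w.map adjSwap).prod (by rw [permAct_prod, h5])).trans ?_
    rw [permLength_eq, permAct_prod, ← h6]
    exact inv_act_le (rv_partition n) w


lemma qq_ne : qq ≠ 0 := by
  unfold qq
  rw [Ne, map_eq_zero_iff _ (IsFractionRing.injective (MvPolynomial (Fin 2) ℚ) K)]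
  exact X_ne_zero 0

lemma tt_ne : tt ≠ 0 := by
  unfold tt
  rw [Ne, map_eq_zero_iff _ (IsFractionRing.injective (MvPolynomial (Fin 2) ℚ) K)]
  exact X_ne_zero 1

lemma qt_nat {a b x y : ℕ} (h : qq ^ a * tt ^ x = qq ^ b * tt ^ y) : a = b := by
  unfold qq tt at h
  rw [← map_pow, ← map_pow, ← map_pow, ← map_pow, ← map_mul, ← map_mul] at h
  have h := IsFractionRing.injective (MvPolynomial (Fin 2) ℚ) K h
  rw [X_pow_eq_monomial, X_pow_eq_monomial, X_pow_eq_monomial, X_pow_eq_monomial,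
    monomial_mul, monomial_mul, mul_one] at h
  have h := monomial_left_injective (one_ne_zero) h
  have := DFunLike.congr_fun h 0
  simpa using this

lemma qt_int {a b : ℕ} {x y : ℤ} (h : qq ^ a * tt ^ x = qq ^ b * tt ^ y) : a = b := by
  have ht := tt_ne
  obtain ⟨M, hM1, hM2⟩ : ∃ M : ℕ, 0 ≤ x + M ∧ 0 ≤ y + M := ⟨x.natAbs + y.natAbs, by omega, by omega⟩
  apply qt_nat (a := a) (b := b) (x := (x + M).toNat) (y := (y + M).toNat)
  rw [← zpow_natCast tt, ← zpow_natCast tt, Int.toNat_of_nonneg hM1, Int.toNat_of_nonneg hM2,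
    zpow_add₀ ht, zpow_add₀ ht, ← mul_assoc, ← mul_assoc, h]

/-- the set counted by `kstat` -/
def kset {n : ℕ} (ν : Fin n → ℕ) (i : Fin n) : Set (Fin n) :=
  {j | (j < i ∧ ν i < ν j) ∨ (i < j ∧ ν i ≤ ν j)}

lemma kstat_eq {n : ℕ} (ν : Fin n → ℕ) (i : Fin n) : kstat ν i = (kset ν i).ncard := by
  unfold kstat
  rw [← Set.ncard_union_eq _ (Set.toFinite _) (Set.toFinite _)]
  · rfl
  · rw [Set.disjoint_left]
    rintro j ⟨h1, _⟩ ⟨h2, _⟩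
    exact absurd h1 (not_lt.2 h2.le)

lemma kstat_congr {n : ℕ} (ν μ : Fin n → ℕ) (i i' : Fin n) (e : Equiv.Perm (Fin n))
    (h : ∀ j, j ∈ kset ν i ↔ e j ∈ kset μ i') : kstat ν i = kstat μ i' := by
  rw [kstat_eq, kstat_eq]
  apply Set.ncard_congr (fun j _ => e j)
  · intro j hj; exact (h j).1 hj
  · intro a b _ _ hab; exact e.injective hab
  · intro b hb
    refine ⟨e.symm b, (h _).2 (by simpa using hb), by simp⟩

lemma kstat_sw {n : ℕ} (i : {i : ℕ // i + 1 < n}) (ν : Fin n → ℕ) (h : ν (lo i) ≠ ν (hi i))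
    (k : Fin n) : kstat (sw i ν) k = kstat ν (adjSwap i k) := by
  have key : ∀ (ν : Fin n → ℕ) (h : ν (lo i) ≠ ν (hi i)) (k j : Fin n), j ∈ kset (sw i ν) k →
      adjSwap i j ∈ kset ν (adjSwap i k) := by
    intro ν h k j hj
    rcases hj with ⟨h1, h2⟩ | ⟨h1, h2⟩
    · by_cases hc : j = lo i ∧ k = hi i
      · obtain ⟨rfl, rfl⟩ := hc
        rw [sw_lo, sw_hi] at h2
        rw [adjSwap_lo, adjSwap_hi]
        right
        exact ⟨h1, h2.le⟩
      · left; exact ⟨adjSwap_lt i h1 hc, h2⟩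
    · by_cases hc : k = lo i ∧ j = hi i
      · obtain ⟨rfl, rfl⟩ := hc
        rw [sw_lo, sw_hi] at h2
        rw [adjSwap_lo, adjSwap_hi]
        left
        exact ⟨h1, lt_of_le_of_ne h2 (Ne.symm h)⟩
      · right; exact ⟨adjSwap_lt i h1 hc, h2⟩
  apply kstat_congr _ _ _ _ (adjSwap i)
  intro j
  refine ⟨key ν h k j, fun hj => ?_⟩
  have := key (sw i ν) (by rw [sw_lo, sw_hi]; exact h.symm) (adjSwap i k) (adjSwap i j)
    (by rw [sw_sw]; exact hj)
  simpa only [adjSwap_adjSwap] using this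

lemma evalPt_sw {n : ℕ} (i : {i : ℕ // i + 1 < n}) (ν : Fin n → ℕ) (h : ν (lo i) ≠ ν (hi i)) :
    evalPt (sw i ν) = evalPt ν ∘ ⇑(adjSwap i) := by
  funext k
  simp only [evalPt, Function.comp, kstat_sw i ν h]
  rfl

lemma kstat_eq_succ {n : ℕ} (i : {i : ℕ // i + 1 < n}) (ν : Fin n → ℕ)
    (h : ν (lo i) = ν (hi i)) : kstat ν (lo i) = kstat ν (hi i) + 1 := by
  rw [kstat_eq, kstat_eq]
  have : kset ν (lo i) = insert (hi i) (kset ν (hi i)) := by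
    ext j
    simp only [kset, Set.mem_ofPred_eq, Set.mem_insert_iff, h]
    by_cases hj : j = hi i
    · subst hj
      simp [Fin.lt_def]
    by_cases hj2 : j = lo i
    · subst hj2
      simp [h]
    have e1 : j < lo i ↔ j < hi i := by
      simp only [Fin.lt_def, Fin.ext_iff, lo, hi] at *; omega
    have e2 : lo i < j ↔ hi i < j := by
      simp only [Fin.lt_def, Fin.ext_iff, lo, hi] at *; omega
    simp only [hj, e1, e2, false_or]
  rw [this, Set.ncard_insert_of_notMem _ (Set.toFinite _)]
  simp [kset]

lemma evalPt_eq {n : ℕ} (i : {i : ℕ // i + 1 < n}) (ν : Fin n → ℕ)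
    (h : ν (lo i) = ν (hi i)) : tt * evalPt ν (lo i) = evalPt ν (hi i) := by
  simp only [evalPt, kstat_eq_succ i ν h, h]
  push_cast
  rw [neg_add, zpow_add₀ tt_ne, zpow_neg_one]
  have := tt_ne
  field_simp

lemma evalPt_ne {n : ℕ} (ν : Fin n → ℕ) (a b : Fin n) (h : ν a ≠ ν b) :
    evalPt ν a ≠ evalPt ν b := fun hc => h (qt_int hc)

lemma tt_evalPt_ne {n : ℕ} (ν : Fin n → ℕ) (a b : Fin n) (h : ν a ≠ ν b) :
    tt * evalPt ν a ≠ evalPt ν b := by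
  intro hc
  apply h
  unfold evalPt at hc
  rw [mul_left_comm, ← zpow_one_add₀ tt_ne] at hc
  exact qt_int hc

lemma rot_val {N : ℕ} (k : Fin (N + 1)) :
    (finRotate (N + 1) k).val = if k.val = N then 0 else k.val + 1 := by
  split_ifs with h
  · have : k = Fin.last N := Fin.ext h
    rw [this, finRotate_last]; rfl
  · have : k.val < N := by have := k.2; omega
    exact coe_finRotate_of_ne_last (fun hc => h (by rw [hc]; rfl))

lemma PhiC_rot {N : ℕ} (ρ : Fin (N + 1) → ℕ) (k : Fin (N + 1)) :
    PhiC ρ (finRotate (N + 1) k) = ρ k + if k.val = N then 1 else 0 := by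
  have hv := rot_val k
  split_ifs at hv ⊢ with h
  · have e : finRotate (N + 1) k = 0 := Fin.ext hv
    have : k = Fin.last N := Fin.ext h
    rw [e, this]; rfl
  · have hk : k.val < N := by have := k.2; omega
    have e : finRotate (N + 1) k = Fin.succ ⟨k.val, hk⟩ := Fin.ext hv
    rw [e]
    rfl

lemma kstat_PhiC {N : ℕ} (ρ : Fin (N + 1) → ℕ) (k : Fin (N + 1)) :
    kstat (PhiC ρ) (finRotate (N + 1) k) = kstat ρ k := by
  symm
  apply kstat_congr _ _ _ _ (finRotate (N + 1))
  intro j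
  simp only [kset, Set.mem_ofPred_eq, PhiC_rot, Fin.lt_def, rot_val]
  have := j.2
  have := k.2
  by_cases h1 : j.val = N <;> by_cases h2 : k.val = N
  · have : j = k := Fin.ext (h1.trans h2.symm)
    subst this
    simp
  all_goals simp only [h1, h2, if_true, if_false]
  all_goals omega

/-- scaling constants in the affine operator -/
def cc {N : ℕ} (k : Fin (N + 1)) : K := if k.val = N then qq⁻¹ else 1

lemma cc_ne {N : ℕ} (k : Fin (N + 1)) : cc k ≠ 0 := by
  unfold cc; split_ifs
  · exact inv_ne_zero qq_ne
  · exact one_ne_zero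

lemma evalPt_PhiC {N : ℕ} (ρ : Fin (N + 1) → ℕ) (k : Fin (N + 1)) :
    cc k * evalPt (PhiC ρ) (finRotate (N + 1) k) = evalPt ρ k := by
  unfold evalPt cc
  rw [kstat_PhiC, PhiC_rot]
  split_ifs
  · rw [pow_succ]
    have := qq_ne
    field_simp
  · simp

lemma kstat_zero {N : ℕ} (ν : Fin (N + 1) → ℕ) (h : ν 0 = 0) : kstat ν 0 = N := by
  rw [kstat_eq]
  have : kset ν 0 = (Finset.univ.erase (0 : Fin (N + 1)) : Finset (Fin (N + 1))) := by
    ext j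
    simp [kset, h, Fin.pos_iff_ne_zero]
  rw [this, Set.ncard_coe_finset]
  simp

lemma evalPt_zero {N : ℕ} (ν : Fin (N + 1) → ℕ) : evalPt ν 0 = tt ^ (-(N : ℤ)) ↔ ν 0 = 0 := by
  constructor
  · intro h
    unfold evalPt at h
    rw [← one_mul (tt ^ (-(N : ℤ))), ← pow_zero qq] at h
    exact qt_int h
  · intro h
    simp only [evalPt, kstat_zero ν h, h, pow_zero, one_mul]

lemma exists_PhiC {N : ℕ} (μ : Fin (N + 1) → ℕ) (h : μ 0 ≠ 0) : ∃ ρ, PhiC ρ = μ := by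
  refine ⟨Fin.snoc (fun i : Fin N => μ i.succ) (μ 0 - 1), ?_⟩
  funext k
  refine Fin.cases ?_ (fun k => ?_) k
  · simp [PhiC]; omega
  · simp [PhiC]


abbrev cf {n : ℕ} (f : MvPolynomial (Fin n) K) (ρ : Fin n → ℕ) : K := coeff (expOf ρ) f

abbrev mon {n : ℕ} (ρ : Fin n → ℕ) : MvPolynomial (Fin n) K := monomial (expOf ρ) 1

lemma expOf_inj {n : ℕ} {ρ τ : Fin n → ℕ} : expOf ρ = expOf τ ↔ ρ = τ :=
  Finsupp.equivFunOnFinite.symm.injective.eq_iff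

lemma expOf_coe {n : ℕ} (u : Fin n →₀ ℕ) : expOf (⇑u) = u := by
  ext k; simp [expOf]

lemma cf_mon {n : ℕ} (ρ τ : Fin n → ℕ) : cf (mon ρ) τ = if ρ = τ then 1 else 0 := by
  simp only [cf, mon, coeff_monomial, expOf_inj]

lemma mon_eq {n : ℕ} (ρ : Fin n → ℕ) : mon ρ = ∏ k, (X k : MvPolynomial (Fin n) K) ^ ρ k := by
  rw [mon, monomial_eq, C_1, one_mul, Finsupp.prod_fintype]
  · rfl
  · intro k; simp

/-- the part of a monomial not involving the two variables -/
def RR {n : ℕ} (i : {i : ℕ // i + 1 < n}) (ρ : Fin n → ℕ) : MvPolynomial (Fin n) K :=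
  ∏ k ∈ (Finset.univ.erase (lo i)).erase (hi i), X k ^ ρ k

lemma mon_split {n : ℕ} (i : {i : ℕ // i + 1 < n}) (ρ : Fin n → ℕ) :
    mon ρ = X (lo i) ^ ρ (lo i) * (X (hi i) ^ ρ (hi i) * RR i ρ) := by
  rw [mon_eq, ← Finset.mul_prod_erase Finset.univ _ (Finset.mem_univ (lo i)),
    ← Finset.mul_prod_erase (Finset.univ.erase (lo i)) _
      (Finset.mem_erase.2 ⟨(lo_ne_hi i).symm, Finset.mem_univ (hi i)⟩)]
  rfl

lemma RR_congr {n : ℕ} (i : {i : ℕ // i + 1 < n}) {ρ τ : Fin n → ℕ}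
    (h : ∀ k, k ≠ lo i → k ≠ hi i → τ k = ρ k) : RR i τ = RR i ρ := by
  apply Finset.prod_congr rfl
  intro k hk
  simp only [Finset.mem_erase, Finset.mem_univ, and_true] at hk
  rw [h k hk.2 hk.1]

/-- replace the two entries -/
def st {n : ℕ} (i : {i : ℕ // i + 1 < n}) (ρ : Fin n → ℕ) (a b : ℕ) : Fin n → ℕ :=
  Function.update (Function.update ρ (lo i) a) (hi i) b

lemma st_lo {n : ℕ} (i : {i : ℕ // i + 1 < n}) (ρ : Fin n → ℕ) (a b : ℕ) :
    st i ρ a b (lo i) = a := by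
  rw [st, Function.update_of_ne (lo_ne_hi i), Function.update_self]
lemma st_hi {n : ℕ} (i : {i : ℕ // i + 1 < n}) (ρ : Fin n → ℕ) (a b : ℕ) :
    st i ρ a b (hi i) = b := by
  rw [st, Function.update_self]
lemma st_ne {n : ℕ} (i : {i : ℕ // i + 1 < n}) (ρ : Fin n → ℕ) (a b : ℕ) (k : Fin n)
    (h1 : k ≠ lo i) (h2 : k ≠ hi i) : st i ρ a b k = ρ k := by
  rw [st, Function.update_of_ne h2, Function.update_of_ne h1]

lemma mon_st {n : ℕ} (i : {i : ℕ // i + 1 < n}) (ρ : Fin n → ℕ) (a b : ℕ) :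
    mon (st i ρ a b) = X (lo i) ^ a * (X (hi i) ^ b * RR i ρ) := by
  rw [mon_split i, st_lo, st_hi, RR_congr i (st_ne i ρ a b)]

lemma swapVars_mon {n : ℕ} (i : {i : ℕ // i + 1 < n}) (ρ : Fin n → ℕ) :
    swapVars (lo i) (hi i) (mon ρ) = X (lo i) ^ ρ (hi i) * (X (hi i) ^ ρ (lo i) * RR i ρ) := by
  rw [mon_split i, swapVars, map_mul, map_mul, map_pow, map_pow, rename_X, rename_X,
    Equiv.swap_apply_left, Equiv.swap_apply_right]
  have : rename (Equiv.swap (lo i) (hi i)) (RR i ρ) = RR i ρ := by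
    unfold RR
    rw [map_prod]
    apply Finset.prod_congr rfl
    intro k hk
    simp only [Finset.mem_erase, Finset.mem_univ, and_true] at hk
    rw [map_pow, rename_X, Equiv.swap_apply_of_ne_of_ne hk.2 hk.1]
  rw [this]
  ring

lemma X_sub_ne {n : ℕ} (i : {i : ℕ // i + 1 < n}) :
    (X (lo i) - X (hi i) : MvPolynomial (Fin n) K) ≠ 0 := by
  intro h
  exact lo_ne_hi i (X_injective (R := K) (sub_eq_zero.1 h))

lemma swapVars_add {n : ℕ} (i j : Fin n) (f g : MvPolynomial (Fin n) K) :
    swapVars i j (f + g) = swapVars i j f + swapVars i j g := map_add _ _ _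

lemma swapVars_C_mul {n : ℕ} (i j : Fin n) (c : K) (f : MvPolynomial (Fin n) K) :
    swapVars i j (C c * f) = C c * swapVars i j f := by
  simp only [swapVars, map_mul, rename_C]

lemma monomial_eq_mon {n : ℕ} (u : Fin n →₀ ℕ) (a : K) :
    monomial u a = C a * mon (⇑u) := by
  rw [mon, expOf_coe, C_mul_monomial, mul_one]

lemma dvd_swap {n : ℕ} (i : {i : ℕ // i + 1 < n}) (f : MvPolynomial (Fin n) K) :
    (X (lo i) - X (hi i)) ∣ f - swapVars (lo i) (hi i) f := by
  induction f using MvPolynomial.induction_on' with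
  | monomial u a =>
    rw [monomial_eq_mon, swapVars_C_mul, ← mul_sub]
    apply Dvd.dvd.mul_left
    rw [swapVars_mon, mon_split i]
    rcases le_total ((⇑u) (hi i)) ((⇑u) (lo i)) with h | h
    · obtain ⟨N, hN⟩ := Nat.exists_eq_add_of_le h
      rw [hN]
      have := sub_dvd_pow_sub_pow (X (lo i) : MvPolynomial (Fin n) K) (X (hi i)) N
      convert this.mul_left (X (lo i) ^ (u (hi i)) * X (hi i) ^ (u (hi i)) * RR i u) using 1
      ring
    · obtain ⟨N, hN⟩ := Nat.exists_eq_add_of_le h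
      rw [hN]
      have := sub_dvd_pow_sub_pow (X (lo i) : MvPolynomial (Fin n) K) (X (hi i)) N
      convert this.mul_left (- X (lo i) ^ (u (lo i)) * X (hi i) ^ (u (lo i)) * RR i u) using 1
      ring
  | add p q hp hq =>
    rw [swapVars_add]
    convert dvd_add hp hq using 1
    ring

lemma hecke_mul {n : ℕ} (i : {i : ℕ // i + 1 < n}) (f : MvPolynomial (Fin n) K) :
    (X (lo i) - X (hi i)) * heckeAt i f = (X (lo i) - X (hi i)) * (C tt * f) -
      (C tt * X (lo i) - X (hi i)) * (f - swapVars (lo i) (hi i) f) := by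
  have hex : ∃ g, f - swapVars (lo i) (hi i) f = (X (lo i) - X (hi i)) * g := dvd_swap i f
  have e : exactDiv (f - swapVars (lo i) (hi i) f) (X (lo i) - X (hi i)) = hex.choose := dif_pos hex
  have h : heckeAt i f = C tt * f - (C tt * X (lo i) - X (hi i)) *
      exactDiv (f - swapVars (lo i) (hi i) f) (X (lo i) - X (hi i)) := rfl
  rw [h, e]
  have := hex.choose_spec
  linear_combination (C tt * X (lo i) - X (hi i)) * this

lemma hecke_unique {n : ℕ} (i : {i : ℕ // i + 1 < n}) (f g : MvPolynomial (Fin n) K)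
    (h : (X (lo i) - X (hi i)) * g = (X (lo i) - X (hi i)) * (C tt * f) -
      (C tt * X (lo i) - X (hi i)) * (f - swapVars (lo i) (hi i) f)) : heckeAt i f = g :=
  mul_left_cancel₀ (X_sub_ne i) ((hecke_mul i f).trans h.symm)

lemma hecke_add {n : ℕ} (i : {i : ℕ // i + 1 < n}) (f g : MvPolynomial (Fin n) K) :
    heckeAt i (f + g) = heckeAt i f + heckeAt i g := by
  apply hecke_unique
  rw [mul_add, hecke_mul, hecke_mul, swapVars_add]
  ring

lemma hecke_C_mul {n : ℕ} (i : {i : ℕ // i + 1 < n}) (c : K) (f : MvPolynomial (Fin n) K) :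
    heckeAt i (C c * f) = C c * heckeAt i f := by
  apply hecke_unique
  rw [mul_left_comm, hecke_mul, swapVars_C_mul]
  ring

/-- The Hecke operator as a linear map. -/
def heckeL {n : ℕ} (i : {i : ℕ // i + 1 < n}) :
    MvPolynomial (Fin n) K →ₗ[K] MvPolynomial (Fin n) K where
  toFun := heckeAt i
  map_add' := hecke_add i
  map_smul' c f := by simp only [smul_eq_C_mul, hecke_C_mul, RingHom.id_apply]

lemma hecke_mon_ge {n : ℕ} (i : {i : ℕ // i + 1 < n}) (ρ : Fin n → ℕ) (b N : ℕ)
    (hb : ρ (hi i) = b) (ha : ρ (lo i) = b + N) :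
    heckeAt i (mon ρ) = C tt * mon (st i ρ b (b + N)) +
      C (1 - tt) * ∑ k ∈ Finset.range N, mon (st i ρ (b + k) (b + (N - k))) := by
  apply hecke_unique
  rw [swapVars_mon, mon_split i ρ, hb, ha]
  simp only [mon_st]
  have hS : (X (lo i) - X (hi i)) * ∑ k ∈ Finset.range N,
      (X (lo i) ^ (b + k) * (X (hi i) ^ (b + (N - k)) * RR i ρ)) =
      X (lo i) ^ b * X (hi i) ^ b * RR i ρ * X (hi i) *
        (X (lo i) ^ N - X (hi i) ^ N : MvPolynomial (Fin n) K) := by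
    rw [← geom_sum₂_mul, Finset.mul_sum, Finset.sum_mul, Finset.mul_sum]
    apply Finset.sum_congr rfl
    intro k hk
    have hk := Finset.mem_range.1 hk
    obtain ⟨c, rfl⟩ : ∃ c, N = k + c + 1 := ⟨N - k - 1, by omega⟩
    rw [show k + c + 1 - k = c + 1 by omega, show k + c + 1 - 1 - k = c by omega]
    ring
  rw [C_sub, C_1]
  linear_combination (1 - C tt) * hS

lemma hecke_mon_lt {n : ℕ} (i : {i : ℕ // i + 1 < n}) (ρ : Fin n → ℕ) (b N : ℕ)
    (hb : ρ (lo i) = b) (ha : ρ (hi i) = b + N) :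
    heckeAt i (mon ρ) = C tt * mon (st i ρ (b + N) b) +
      C (tt - 1) * ∑ k ∈ Finset.range N, mon (st i ρ (b + k) (b + (N - k))) := by
  apply hecke_unique
  rw [swapVars_mon, mon_split i ρ, hb, ha]
  simp only [mon_st]
  have hS : (X (lo i) - X (hi i)) * ∑ k ∈ Finset.range N,
      (X (lo i) ^ (b + k) * (X (hi i) ^ (b + (N - k)) * RR i ρ)) =
      X (lo i) ^ b * X (hi i) ^ b * RR i ρ * X (hi i) *
        (X (lo i) ^ N - X (hi i) ^ N : MvPolynomial (Fin n) K) := by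
    rw [← geom_sum₂_mul, Finset.mul_sum, Finset.sum_mul, Finset.mul_sum]
    apply Finset.sum_congr rfl
    intro k hk
    have hk := Finset.mem_range.1 hk
    obtain ⟨c, rfl⟩ : ∃ c, N = k + c + 1 := ⟨N - k - 1, by omega⟩
    rw [show k + c + 1 - k = c + 1 by omega, show k + c + 1 - 1 - k = c by omega]
    ring
  rw [C_sub, C_1]
  linear_combination (C tt - 1) * hS

lemma cf_form {n : ℕ} {α β : K} {s : Fin n → ℕ} {N : ℕ} {v : ℕ → Fin n → ℕ} (τ : Fin n → ℕ) :
    cf (C α * mon s + C β * ∑ k ∈ Finset.range N, mon (v k)) τ =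
      α * (if s = τ then 1 else 0) + β * ∑ k ∈ Finset.range N, if v k = τ then 1 else 0 := by
  simp only [cf, coeff_add, coeff_C_mul, coeff_sum]
  simp only [coeff_monomial, expOf_inj]

lemma cf_form_ne {n : ℕ} {α β : K} {s : Fin n → ℕ} {N : ℕ} {v : ℕ → Fin n → ℕ} {τ : Fin n → ℕ}
    (h : cf (C α * mon s + C β * ∑ k ∈ Finset.range N, mon (v k)) τ ≠ 0) :
    s = τ ∨ ∃ k < N, v k = τ := by
  by_contra! hc
  apply h
  rw [cf_form, if_neg hc.1, Finset.sum_eq_zero]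
  · simp
  · intro k hk
    rw [if_neg (hc.2 k (Finset.mem_range.1 hk))]

lemma InStr_st {n : ℕ} (i : {i : ℕ // i + 1 < n}) (ρ : Fin n → ℕ) (a b : ℕ)
    (h : a + b = ρ (lo i) + ρ (hi i)) (h1 : min (ρ (lo i)) (ρ (hi i)) ≤ a)
    (h2 : a ≤ max (ρ (lo i)) (ρ (hi i))) : InStr i ρ (st i ρ a b) := by
  refine ⟨st_ne i ρ a b, ?_⟩
  rw [st_lo, st_hi]
  exact ⟨h, h1, h2⟩

lemma hecke_mon_supp {n : ℕ} (i : {i : ℕ // i + 1 < n}) (ρ τ : Fin n → ℕ)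
    (h : cf (heckeAt i (mon ρ)) τ ≠ 0) : InStr i ρ τ := by
  rcases le_total (ρ (hi i)) (ρ (lo i)) with hc | hc
  · obtain ⟨N, hN⟩ := Nat.exists_eq_add_of_le hc
    rw [hecke_mon_ge i ρ _ N rfl hN] at h
    rcases cf_form_ne h with rfl | ⟨k, hk, rfl⟩ <;> apply InStr_st <;> omega
  · obtain ⟨N, hN⟩ := Nat.exists_eq_add_of_le hc
    rw [hecke_mon_lt i ρ _ N rfl hN] at h
    rcases cf_form_ne h with rfl | ⟨k, hk, rfl⟩ <;> apply InStr_st <;> omega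

lemma hecke_mon_sw {n : ℕ} (i : {i : ℕ // i + 1 < n}) (ρ : Fin n → ℕ)
    (h : ρ (hi i) < ρ (lo i)) : cf (heckeAt i (mon ρ)) (sw i ρ) = 1 := by
  obtain ⟨N, hN⟩ := Nat.exists_eq_add_of_le h.le
  have e : st i ρ (ρ (hi i)) (ρ (hi i) + N) = sw i ρ := by
    apply ext_sw i
    · intro k h1 h2; rw [sw_ne i ρ k h1 h2, st_ne i ρ _ _ k h1 h2]
    · rw [st_lo, sw_lo]
    · rw [st_hi, sw_hi, hN]
  rw [hecke_mon_ge i ρ _ N rfl hN, cf_form, if_pos e, Finset.sum_eq_single 0]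
  · rw [add_zero, Nat.sub_zero, if_pos e]; ring
  · intro k hk hk0
    rw [if_neg]
    intro hc
    have := congrFun hc (lo i)
    rw [st_lo, sw_lo] at this
    omega
  · intro h0
    exact absurd (Finset.mem_range.2 (by omega)) h0

lemma hecke_mon_self {n : ℕ} (i : {i : ℕ // i + 1 < n}) (ρ : Fin n → ℕ)
    (h : ρ (hi i) < ρ (lo i)) : cf (heckeAt i (mon ρ)) ρ = 0 := by
  obtain ⟨N, hN⟩ := Nat.exists_eq_add_of_le h.le
  rw [hecke_mon_ge i ρ _ N rfl hN, cf_form, if_neg, Finset.sum_eq_zero]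
  · simp
  · intro k hk
    rw [if_neg]
    intro hc
    have := congrFun hc (lo i)
    rw [st_lo] at this
    have := Finset.mem_range.1 hk
    omega
  · intro hc
    have := congrFun hc (lo i)
    rw [st_lo] at this
    omega

lemma cf_hecke {n : ℕ} (i : {i : ℕ // i + 1 < n}) (f : MvPolynomial (Fin n) K) (τ : Fin n → ℕ) :
    cf (heckeAt i f) τ = ∑ u ∈ f.support, cf f (⇑u) * cf (heckeAt i (mon (⇑u))) τ := by
  have h1 : heckeAt i f = heckeL i f := rfl
  conv_lhs => rw [h1, f.as_sum, map_sum]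
  simp only [cf, coeff_sum]
  apply Finset.sum_congr rfl
  intro u _
  have h2 : ∀ g, heckeL i g = heckeAt i g := fun _ => rfl
  rw [monomial_eq_mon, h2, hecke_C_mul, coeff_C_mul, expOf_coe]

lemma hecke_supp {n : ℕ} (i : {i : ℕ // i + 1 < n}) (f : MvPolynomial (Fin n) K) (τ : Fin n → ℕ)
    (h : cf (heckeAt i f) τ ≠ 0) : ∃ ρ, cf f ρ ≠ 0 ∧ InStr i ρ τ := by
  rw [cf_hecke] at h
  obtain ⟨u, _, hu⟩ := Finset.exists_ne_zero_of_sum_ne_zero h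
  exact ⟨u, left_ne_zero_of_mul hu, hecke_mon_supp i u τ (right_ne_zero_of_mul hu)⟩

lemma hecke_lead {n : ℕ} (i : {i : ℕ // i + 1 < n}) (f : MvPolynomial (Fin n) K) (κ τ : Fin n → ℕ)
    (h : ∀ ρ, cf f ρ ≠ 0 → InStr i ρ τ → ρ = κ) :
    cf (heckeAt i f) τ = cf f κ * cf (heckeAt i (mon κ)) τ := by
  rw [cf_hecke, Finset.sum_eq_single (expOf κ)]
  · rfl
  · intro u _ hu
    by_contra hc
    apply hu
    rw [← h u (left_ne_zero_of_mul hc) (hecke_mon_supp i u τ (right_ne_zero_of_mul hc)), expOf_coe]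
  · intro h0
    rw [notMem_support_iff] at h0
    have : cf f (⇑(expOf κ)) = 0 := by rw [cf, expOf_coe]; exact h0
    rw [this, zero_mul]

lemma eval_swap {n : ℕ} (i : {i : ℕ // i + 1 < n}) (f : MvPolynomial (Fin n) K) (p : Fin n → K) :
    eval p (swapVars (lo i) (hi i) f) = eval (p ∘ ⇑(adjSwap i)) f := by
  rw [swapVars, eval_rename]; rfl

lemma hecke_eval_ne {n : ℕ} (i : {i : ℕ // i + 1 < n}) (f : MvPolynomial (Fin n) K)
    (ν : Fin n → ℕ) (h : ν (lo i) ≠ ν (hi i)) :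
    (evalPt ν (lo i) - evalPt ν (hi i)) * eval (evalPt ν) (heckeAt i f) =
      (evalPt ν (lo i) - evalPt ν (hi i)) * (tt * eval (evalPt ν) f) -
      (tt * evalPt ν (lo i) - evalPt ν (hi i)) *
        (eval (evalPt ν) f - eval (evalPt (sw i ν)) f) := by
  have := congrArg (eval (evalPt ν)) (hecke_mul i f)
  simp only [map_mul, map_sub, eval_X, eval_C, eval_swap] at this
  rw [evalPt_sw i ν h]
  exact this

lemma hecke_eval_eq {n : ℕ} (i : {i : ℕ // i + 1 < n}) (f : MvPolynomial (Fin n) K)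
    (ν : Fin n → ℕ) (h : ν (lo i) = ν (hi i)) :
    eval (evalPt ν) (heckeAt i f) = tt * eval (evalPt ν) f := by
  have : heckeAt i f = C tt * f - (C tt * X (lo i) - X (hi i)) *
      exactDiv (f - swapVars (lo i) (hi i) f) (X (lo i) - X (hi i)) := rfl
  rw [this]
  simp only [map_mul, map_sub, eval_X, eval_C, evalPt_eq i ν h]
  ring

lemma hecke_eval_zero {n : ℕ} (i : {i : ℕ // i + 1 < n}) (f : MvPolynomial (Fin n) K)
    (ν : Fin n → ℕ) (h1 : eval (evalPt ν) f = 0) (h2 : eval (evalPt (sw i ν)) f = 0) :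
    eval (evalPt ν) (heckeAt i f) = 0 := by
  by_cases h : ν (lo i) = ν (hi i)
  · rw [hecke_eval_eq i f ν h, h1, mul_zero]
  · have := hecke_eval_ne i f ν h
    rw [h1, h2] at this
    have h3 := sub_ne_zero.2 (evalPt_ne ν _ _ h)
    have h4 : (evalPt ν (lo i) - evalPt ν (hi i)) * eval (evalPt ν) (heckeAt i f) = 0 := by
      rw [this]; ring
    exact (mul_eq_zero.1 h4).resolve_left h3


/-- The affine substitution. -/
def AA {N : ℕ} : MvPolynomial (Fin (N + 1)) K →ₐ[K] MvPolynomial (Fin (N + 1)) K :=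
  aeval (fun k => C (cc k) * X (finRotate (N + 1) k))

lemma AA_mon {N : ℕ} (ρ : Fin (N + 1) → ℕ) :
    AA (mon ρ) = C (∏ k, cc k ^ ρ k) * mon (ρ ∘ ⇑(finRotate (N + 1)).symm) := by
  rw [mon_eq, mon_eq, map_prod, map_prod]
  simp only [AA, map_pow, aeval_X, mul_pow, Finset.prod_mul_distrib]
  congr 1
  rw [← Equiv.prod_comp (finRotate (N + 1))
    (fun j => (X j : MvPolynomial (Fin (N + 1)) K) ^ (ρ ∘ ⇑(finRotate (N + 1)).symm) j)]
  simp only [Function.comp, Equiv.symm_apply_apply]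

lemma cf_AA {N : ℕ} (f : MvPolynomial (Fin (N + 1)) K) (τ : Fin (N + 1) → ℕ) :
    cf (AA f) τ = (∏ k, cc k ^ τ (finRotate (N + 1) k)) * cf f (τ ∘ ⇑(finRotate (N + 1))) := by
  induction f using MvPolynomial.induction_on' with
  | monomial u a =>
    rw [monomial_eq_mon, map_mul, AA_mon]
    have hC : (AA (C a) : MvPolynomial (Fin (N + 1)) K) = C a := by
      simp [AA]
    rw [hC]
    simp only [cf, coeff_C_mul]
    rw [show coeff (expOf τ) (mon (⇑u ∘ ⇑(finRotate (N + 1)).symm)) = _ from cf_mon _ _,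
      show coeff (expOf (τ ∘ ⇑(finRotate (N + 1)))) (mon ⇑u) = _ from cf_mon _ _]
    by_cases h : ⇑u = τ ∘ ⇑(finRotate (N + 1))
    · have h2 : ⇑u ∘ ⇑(finRotate (N + 1)).symm = τ := by
        rw [h]; funext k; simp
      rw [if_pos h, if_pos h2, h]
      simp only [Function.comp]
      ring
    · have h2 : ⇑u ∘ ⇑(finRotate (N + 1)).symm ≠ τ := by
        intro hc; apply h; rw [← hc]; funext k; simp
      rw [if_neg h, if_neg h2]
      simp
  | add p q hp hq =>
    simp only [cf, map_add, coeff_add] at *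
    rw [hp, hq]; ring

lemma eval_AA {N : ℕ} (f : MvPolynomial (Fin (N + 1)) K) (p : Fin (N + 1) → K) :
    eval p (AA f) = eval (fun k => cc k * p (finRotate (N + 1) k)) f := by
  induction f using MvPolynomial.induction_on with
  | C a => simp [AA]
  | add p q hp hq => simp only [map_add, hp, hq]
  | mul_X p k hp =>
    rw [map_mul, map_mul, hp, map_mul]
    simp [AA]

/-- The raising operator. -/
def PhiP {N : ℕ} (f : MvPolynomial (Fin (N + 1)) K) : MvPolynomial (Fin (N + 1)) K :=
  X 0 * AA f - C (tt ^ (-(N : ℤ))) * AA f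

lemma expOf_PhiC {N : ℕ} (ρ : Fin (N + 1) → ℕ) :
    expOf (PhiC ρ) = Finsupp.single 0 1 + expOf (ρ ∘ ⇑(finRotate (N + 1)).symm) := by
  ext k
  obtain ⟨j, rfl⟩ := (finRotate (N + 1)).surjective k
  simp only [expOf, Finsupp.equivFunOnFinite_symm_apply_apply, PhiC_rot, Finsupp.add_apply,
    Function.comp, Equiv.symm_apply_apply, Finsupp.single_apply]
  have := rot_val j
  by_cases h : j.val = N
  · rw [if_pos h] at this
    have : finRotate (N + 1) j = 0 := Fin.ext this
    rw [this]; simp [h]; omega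
  · rw [if_neg h] at this
    have : ¬ (0 = finRotate (N + 1) j) := by
      intro hc; rw [← hc] at this; simp at this
    rw [if_neg h, if_neg this]; omega

lemma cf_PhiP {N : ℕ} (f : MvPolynomial (Fin (N + 1)) K) (ρ : Fin (N + 1) → ℕ) :
    cf (PhiP f) (PhiC ρ) = (∏ k, cc k ^ ρ k) * cf f ρ - tt ^ (-(N : ℤ)) * cf (AA f) (PhiC ρ) := by
  unfold PhiP
  rw [cf, coeff_sub, coeff_C_mul]
  congr 1
  rw [expOf_PhiC, coeff_X_mul]
  have := cf_AA f (ρ ∘ ⇑(finRotate (N + 1)).symm)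
  rw [cf] at this
  rw [this]
  have e : (ρ ∘ ⇑(finRotate (N + 1)).symm) ∘ ⇑(finRotate (N + 1)) = ρ := by
    funext k; simp
  rw [e]
  simp

lemma cf_PhiP_zero {N : ℕ} (f : MvPolynomial (Fin (N + 1)) K) (σ : Fin (N + 1) → ℕ) (h : σ 0 = 0) :
    cf (PhiP f) σ = - (tt ^ (-(N : ℤ)) * cf (AA f) σ) := by
  unfold PhiP
  rw [cf, coeff_sub, coeff_C_mul, coeff_X_mul', if_neg, zero_sub]
  simp [expOf, h]

/-- The properties of the interpolation polynomials which we construct. -/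
structure Good {n : ℕ} (μ : Fin n → ℕ) (F : MvPolynomial (Fin n) K) : Prop where
  deg : ∀ ρ, cf F ρ ≠ 0 → csize ρ ≤ csize μ
  top : ∀ ρ, cf F ρ ≠ 0 → csize ρ = csize μ → CLe ρ μ
  lead : cf F μ ≠ 0
  van : ∀ ν, csize ν ≤ csize μ → ν ≠ μ → eval (evalPt ν) F = 0
  nv : eval (evalPt μ) F ≠ 0

lemma Good.phi {N : ℕ} {μ : Fin (N + 1) → ℕ} {F : MvPolynomial (Fin (N + 1)) K} (h : Good μ F) :
    Good (PhiC μ) (PhiP F) := by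
  have hA : ∀ σ, cf (AA F) σ ≠ 0 → csize σ ≤ csize μ := by
    intro σ hσ
    rw [cf_AA] at hσ
    have := h.deg _ (right_ne_zero_of_mul hσ)
    rwa [csize_comp] at this
  have hA0 : ∀ σ, csize σ = csize μ + 1 → cf (AA F) σ = 0 := by
    intro σ hσ
    by_contra hc
    have := hA σ hc
    omega
  refine ⟨?_, ?_, ?_, ?_, ?_⟩
  · intro σ hσ
    rw [csize_PhiC]
    by_cases h0 : σ 0 = 0
    · rw [cf_PhiP_zero _ _ h0] at hσ
      have := hA σ (right_ne_zero_of_mul (neg_ne_zero.1 hσ))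
      omega
    · obtain ⟨ρ, rfl⟩ := exists_PhiC σ h0
      by_cases h1 : cf F ρ = 0
      · rw [cf_PhiP, h1, mul_zero, zero_sub] at hσ
        have := hA _ (right_ne_zero_of_mul (neg_ne_zero.1 hσ))
        omega
      · have := h.deg ρ h1
        rw [csize_PhiC]; omega
  · intro σ hσ hs
    rw [csize_PhiC] at hs
    by_cases h0 : σ 0 = 0
    · rw [cf_PhiP_zero _ _ h0, hA0 σ hs] at hσ
      simp at hσ
    · obtain ⟨ρ, rfl⟩ := exists_PhiC σ h0
      rw [cf_PhiP, hA0 _ hs, mul_zero, sub_zero] at hσ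
      rw [csize_PhiC] at hs
      exact (h.top ρ (right_ne_zero_of_mul hσ) (by omega)).PhiC
  · rw [cf_PhiP, hA0 _ (csize_PhiC μ), mul_zero, sub_zero]
    exact mul_ne_zero (Finset.prod_ne_zero_iff.2 fun k _ => pow_ne_zero _ (cc_ne k)) h.lead
  · intro ν hν hne
    have e : eval (evalPt ν) (PhiP F) = (evalPt ν 0 - tt ^ (-(N : ℤ))) * eval (evalPt ν) (AA F) := by
      simp only [PhiP, map_sub, map_mul, eval_X, eval_C]; ring
    rw [e]
    by_cases h0 : ν 0 = 0
    · rw [(evalPt_zero ν).2 h0, sub_self, zero_mul]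
    · obtain ⟨ρ, rfl⟩ := exists_PhiC ν h0
      rw [eval_AA]
      simp only [evalPt_PhiC]
      rw [csize_PhiC, csize_PhiC] at hν
      rw [h.van ρ (by omega) (by rintro rfl; exact hne rfl), mul_zero]
  · have e : eval (evalPt (PhiC μ)) (PhiP F) = (evalPt (PhiC μ) 0 - tt ^ (-(N : ℤ))) *
        eval (evalPt (PhiC μ)) (AA F) := by
      simp only [PhiP, map_sub, map_mul, eval_X, eval_C]; ring
    rw [e, eval_AA]
    simp only [evalPt_PhiC]
    refine mul_ne_zero (sub_ne_zero.2 fun hc => ?_) h.nv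
    have := (evalPt_zero _).1 hc
    simp [PhiC] at this

lemma Good.hecke {n : ℕ} {κ : Fin n → ℕ} {F : MvPolynomial (Fin n) K} (h : Good κ F)
    (i : {i : ℕ // i + 1 < n}) (hi' : κ (hi i) < κ (lo i)) :
    ∃ G, Good (sw i κ) G := by
  set c : K := eval (evalPt κ) (heckeAt i F) / eval (evalPt κ) F with hc
  refine ⟨heckeAt i F - C c * F, ?_, ?_, ?_, ?_, ?_⟩
  · intro ρ hρ
    rw [csize_sw]
    by_cases h1 : cf F ρ = 0
    · have h2 : cf (heckeAt i F) ρ ≠ 0 := by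
        simpa only [cf, coeff_sub, coeff_C_mul, h1, mul_zero, sub_zero] using hρ
      obtain ⟨τ, h3, h4⟩ := hecke_supp i F ρ h2
      rw [h4.csize]; exact h.deg τ h3
    · exact h.deg ρ h1
  · intro ρ hρ hs
    rw [csize_sw] at hs
    by_cases h1 : cf F ρ = 0
    · have h2 : cf (heckeAt i F) ρ ≠ 0 := by
        simpa only [cf, coeff_sub, coeff_C_mul, h1, mul_zero, sub_zero] using hρ
      obtain ⟨τ, h3, h4⟩ := hecke_supp i F ρ h2
      exact h4.cle (h.top τ h3 (by rw [← h4.csize, hs])) hi'.le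
    · exact (InStr.self i ρ).cle (h.top ρ h1 hs) hi'.le
  · have h1 : cf F (sw i κ) = 0 := by
      by_contra hne
      exact not_cle_sw hi' (h.top _ hne (csize_sw i κ))
    have h2 : cf (heckeAt i F) (sw i κ) = cf F κ * cf (heckeAt i (mon κ)) (sw i κ) := by
      apply hecke_lead
      intro ρ hρ hstr
      have hle := h.top ρ hρ (by rw [← hstr.csize, csize_sw])
      rcases hstr.eq_or (fun m => (hle.2 m n).trans
        (NN_sw i κ m n (by have := i.2; omega)).ge) with h3 | h3
      · exact absurd (h3 ▸ h1) hρ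
      · rw [← sw_sw i ρ, ← h3, sw_sw]
    have h3 : cf (heckeAt i F - C c * F) (sw i κ) = cf F κ := by
      simp only [cf, coeff_sub, coeff_C_mul]
      rw [show coeff (expOf (sw i κ)) F = 0 from h1,
        show coeff (expOf (sw i κ)) (heckeAt i F) = _ from h2, hecke_mon_sw i κ hi']
      ring
    rw [h3]; exact h.lead
  · intro ν hν hne
    rw [csize_sw] at hν
    rw [map_sub, map_mul, eval_C]
    by_cases h1 : ν = κ
    · subst h1
      rw [hc, div_mul_cancel₀ _ h.nv, sub_self]
    · rw [h.van ν hν h1, mul_zero, sub_zero]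
      apply hecke_eval_zero i F ν (h.van ν hν h1)
      apply h.van _ (by rw [csize_sw]; exact hν)
      rintro rfl
      exact hne (sw_sw i ν).symm
  · have hne : sw i κ ≠ κ := by
      intro hc'
      have := congrFun hc' (lo i)
      rw [sw_lo] at this
      omega
    have h0 : eval (evalPt (sw i κ)) F = 0 := h.van _ (csize_sw i κ).le hne
    rw [map_sub, map_mul, h0, mul_zero, sub_zero]
    intro hz
    have h1 : (sw i κ) (lo i) ≠ (sw i κ) (hi i) := by rw [sw_lo, sw_hi]; omega
    have h2 := hecke_eval_ne i F (sw i κ) h1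
    rw [hz, h0, sw_sw] at h2
    have h3 := tt_evalPt_ne _ _ _ h1
    have h4 : (tt * evalPt (sw i κ) (lo i) - evalPt (sw i κ) (hi i)) * eval (evalPt κ) F = 0 := by
      linear_combination (-1 : K) * h2
    rcases mul_eq_zero.1 h4 with h5 | h5
    · exact h3 (sub_eq_zero.1 h5)
    · exact h.nv h5

lemma csize_eq_zero {n : ℕ} {μ : Fin n → ℕ} (h : csize μ = 0) : μ = fun _ => 0 := by
  funext k
  exact (Finset.sum_eq_zero_iff.1 h) k (Finset.mem_univ k)

lemma good_zero {n : ℕ} {μ : Fin n → ℕ} (h : csize μ = 0) : Good μ (1 : MvPolynomial (Fin n) K) := by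
  have h1 : (1 : MvPolynomial (Fin n) K) = mon μ := by
    rw [csize_eq_zero h, mon_eq]; simp
  have h2 : ∀ ρ, cf (1 : MvPolynomial (Fin n) K) ρ ≠ 0 → ρ = μ := by
    intro ρ hρ
    rw [h1, cf_mon] at hρ
    by_contra hc
    exact hρ (if_neg (Ne.symm hc))
  refine ⟨fun ρ hρ => by rw [h2 ρ hρ], fun ρ hρ _ => by rw [h2 ρ hρ]; exact CLe.refl _, ?_, ?_, ?_⟩
  · rw [h1, cf_mon, if_pos rfl]; exact one_ne_zero
  · intro ν hν hne
    exact absurd ((csize_eq_zero (by omega : csize ν = 0)).trans (csize_eq_zero h).symm) hne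
  · rw [map_one]; exact one_ne_zero

lemma exists_good {n : ℕ} (μ : Fin n → ℕ) : ∃ F, Good μ F := by
  have key : ∀ (d : ℕ) (μ : Fin n → ℕ), csize μ = d → ∃ F, Good μ F := by
    intro d
    induction d with
    | zero => intro μ hμ; exact ⟨1, good_zero hμ⟩
    | succ d ihd =>
      have key2 : ∀ (p : ℕ) (hp : p < n) (μ : Fin n → ℕ), csize μ = d + 1 → μ ⟨p, hp⟩ ≠ 0 →
          ∃ F, Good μ F := by
        intro p
        induction p with
        | zero =>
          intro hp μ hμ h0
          obtain ⟨N, rfl⟩ : ∃ N, n = N + 1 := ⟨n - 1, by omega⟩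
          obtain ⟨ρ, rfl⟩ := exists_PhiC μ h0
          rw [csize_PhiC] at hμ
          obtain ⟨F, hF⟩ := ihd ρ (by omega)
          exact ⟨_, hF.phi⟩
        | succ p ihp =>
          intro hp μ hμ h0
          set i : {i : ℕ // i + 1 < n} := ⟨p, hp⟩ with hidef
          have h0' : μ (hi i) ≠ 0 := h0
          by_cases hlt : μ (lo i) < μ (hi i)
          · obtain ⟨F, hF⟩ := ihp (by omega) (sw i μ) (by rw [csize_sw, hμ])
              (by have := sw_lo i μ; exact this ▸ h0')
            obtain ⟨G, hG⟩ := hF.hecke i (by rw [sw_lo, sw_hi]; exact hlt)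
            rw [sw_sw] at hG
            exact ⟨G, hG⟩
          · exact ihp (by omega) μ hμ (by change μ (lo i) ≠ 0; omega)
      intro μ hμ
      have : ∃ k, μ k ≠ 0 := by
        by_contra! hc
        have : csize μ = 0 := Finset.sum_eq_zero fun k _ => hc k
        omega
      obtain ⟨k, hk⟩ := this
      exact key2 k.val k.2 μ hμ hk
  exact key _ μ rfl

/-- A choice of interpolation polynomials. -/
def FF {n : ℕ} (μ : Fin n → ℕ) : MvPolynomial (Fin n) K := (exists_good μ).choose

lemma FF_good {n : ℕ} (μ : Fin n → ℕ) : Good μ (FF μ) := (exists_good μ).choose_spec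


lemma cf_sum_FF {n : ℕ} (S : Finset (Fin n → ℕ)) (c : (Fin n → ℕ) → K) (τ : Fin n → ℕ) :
    cf (∑ μ ∈ S, C (c μ) * FF μ) τ = ∑ μ ∈ S, c μ * cf (FF μ) τ := by
  simp only [cf, coeff_sum, coeff_C_mul]

lemma cf_sub {n : ℕ} (f g : MvPolynomial (Fin n) K) (τ : Fin n → ℕ) :
    cf (f - g) τ = cf f τ - cf g τ := by
  simp only [cf, coeff_sub]

lemma eq_zero_of_cf {n : ℕ} {f : MvPolynomial (Fin n) K} (h : ∀ ρ, cf f ρ = 0) : f = 0 := by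
  ext u
  have := h ⇑u
  rw [cf, expOf_coe] at this
  rw [this, coeff_zero]

lemma indep_FF {n : ℕ} (d : ℕ) (S : Finset (Fin n → ℕ)) (hS : ∀ μ ∈ S, csize μ = d)
    (c : (Fin n → ℕ) → K) (h : ∀ τ ∈ S, ∑ μ ∈ S, c μ * cf (FF μ) τ = 0) : ∀ μ ∈ S, c μ = 0 := by
  by_contra! hc
  obtain ⟨μ0, h0, h0'⟩ := hc
  obtain ⟨μ, hm⟩ := Finset.exists_maximalFor (fun (μ : Fin n → ℕ) (m r : ℕ) => NN m r μ)
    (S.filter fun μ => c μ ≠ 0) ⟨μ0, Finset.mem_filter.2 ⟨h0, h0'⟩⟩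
  obtain ⟨hμS, hμc⟩ := Finset.mem_filter.1 hm.1
  have h1 := h μ hμS
  rw [Finset.sum_eq_single_of_mem μ hμS] at h1
  · exact (mul_ne_zero hμc (FF_good μ).lead) h1
  · intro κ hκ hne
    by_contra hz
    have hle := (FF_good κ).top μ (right_ne_zero_of_mul hz) ((hS μ hμS).trans (hS κ hκ).symm)
    have h2 := hm.2 (Finset.mem_filter.2 ⟨hκ, left_ne_zero_of_mul hz⟩) (fun m r => hle.2 m r)
    exact hne (NN_inj fun m r => le_antisymm (h2 m r) (hle.2 m r))

lemma eval_sum_FF {n : ℕ} (d : ℕ) (S : Finset (Fin n → ℕ)) (hS : ∀ μ ∈ S, csize μ = d)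
    (c : (Fin n → ℕ) → K) (ν : Fin n → ℕ) (hν : csize ν ≤ d) :
    eval (evalPt ν) (∑ μ ∈ S, C (c μ) * FF μ) =
      if ν ∈ S then c ν * eval (evalPt ν) (FF ν) else 0 := by
  simp only [map_sum, map_mul, eval_C]
  split_ifs with h
  · rw [Finset.sum_eq_single_of_mem ν h]
    intro κ hκ hne
    rw [(FF_good κ).van ν (hν.trans (hS κ hκ).ge) hne.symm, mul_zero]
  · apply Finset.sum_eq_zero
    intro κ hκ
    rw [(FF_good κ).van ν (hν.trans (hS κ hκ).ge) (fun hc => h (hc ▸ hκ)), mul_zero]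

/-- All compositions of size `d`. -/
def allC (n d : ℕ) : Finset (Fin n → ℕ) := Finset.piAntidiag Finset.univ d

lemma mem_allC {n d : ℕ} (μ : Fin n → ℕ) : μ ∈ allC n d ↔ csize μ = d := by
  simp [allC, csize]

lemma span_FF {n : ℕ} (d : ℕ) (b : (Fin n → ℕ) → K) :
    ∃ c : (Fin n → ℕ) → K, ∀ τ ∈ allC n d, ∑ μ ∈ allC n d, c μ * cf (FF μ) τ = b τ := by
  let L : (allC n d → K) →ₗ[K] (allC n d → K) :=
    { toFun := fun c τ => ∑ μ : allC n d, c μ * cf (FF μ.1) τ.1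
      map_add' := by
        intro c c'
        funext τ
        simp only [Pi.add_apply, add_mul, Finset.sum_add_distrib]
      map_smul' := by
        intro a c
        funext τ
        simp only [Pi.smul_apply, smul_eq_mul, RingHom.id_apply, Finset.mul_sum, mul_assoc] }
  have hext : ∀ (c : allC n d → K) (τ : Fin n → ℕ),
      ∑ μ ∈ allC n d, (if h : μ ∈ allC n d then c ⟨μ, h⟩ else 0) * cf (FF μ) τ =
        ∑ μ : allC n d, c μ * cf (FF μ.1) τ := by
    intro c τ
    rw [← Finset.sum_coe_sort]
    apply Finset.sum_congr rfl
    intro μ _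
    rw [dif_pos μ.2]
  have hinj : Function.Injective L := by
    rw [injective_iff_map_eq_zero]
    intro c hc
    funext μ
    have := indep_FF d (allC n d) (fun μ hμ => (mem_allC μ).1 hμ)
      (fun μ => if h : μ ∈ allC n d then c ⟨μ, h⟩ else 0) (by
        intro τ hτ
        rw [hext]
        exact congrFun hc ⟨τ, hτ⟩) μ.1 μ.2
    simpa using this
  obtain ⟨c, hc⟩ := LinearMap.injective_iff_surjective.1 hinj (fun τ => b τ.1)
  refine ⟨fun μ => if h : μ ∈ allC n d then c ⟨μ, h⟩ else 0, ?_⟩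
  intro τ hτ
  rw [hext]
  exact congrFun hc ⟨τ, hτ⟩

lemma cf_sum_FF_deg {n : ℕ} (d : ℕ) (S : Finset (Fin n → ℕ)) (hS : ∀ μ ∈ S, csize μ = d)
    (c : (Fin n → ℕ) → K) (ρ : Fin n → ℕ) (h : cf (∑ μ ∈ S, C (c μ) * FF μ) ρ ≠ 0) :
    csize ρ ≤ d := by
  rw [cf_sum_FF] at h
  obtain ⟨κ, hκ, hz⟩ := Finset.exists_ne_zero_of_sum_ne_zero h
  exact ((FF_good κ).deg ρ (right_ne_zero_of_mul hz)).trans (hS κ hκ).le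

lemma vanish_zero {n : ℕ} (d : ℕ) : ∀ g : MvPolynomial (Fin n) K,
    (∀ ρ, cf g ρ ≠ 0 → csize ρ < d) → (∀ ν, csize ν < d → eval (evalPt ν) g = 0) → g = 0 := by
  induction d with
  | zero =>
    intro g h _
    apply eq_zero_of_cf
    intro ρ
    by_contra hc
    exact absurd (h ρ hc) (Nat.not_lt_zero _)
  | succ d ih =>
    intro g h hv
    have hS : ∀ μ ∈ allC n d, csize μ = d := fun μ hμ => (mem_allC μ).1 hμ
    obtain ⟨c, hc⟩ := span_FF d (fun τ => cf g τ)
    have hz : g - ∑ μ ∈ allC n d, C (c μ) * FF μ = 0 := by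
      apply ih
      · intro ρ hρ
        have h1 : csize ρ ≤ d := by
          by_contra hlt
          apply hρ
          rw [cf_sub]
          have e1 : cf g ρ = 0 := by
            by_contra hne
            have := h ρ hne
            omega
          have e2 : cf (∑ μ ∈ allC n d, C (c μ) * FF μ) ρ = 0 := by
            by_contra hne
            exact hlt (cf_sum_FF_deg d _ hS c ρ hne)
          rw [e1, e2, sub_zero]
        refine lt_of_le_of_ne h1 fun he => hρ ?_
        rw [cf_sub, cf_sum_FF, hc ρ ((mem_allC ρ).2 he), sub_self]
      · intro ν hν
        rw [map_sub, hv ν (by omega), eval_sum_FF d _ hS c ν hν.le, if_neg, sub_zero]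
        intro hm
        have := hS ν hm
        omega
    rw [sub_eq_zero] at hz
    rw [hz]
    apply Finset.sum_eq_zero
    intro μ hμ
    have h1 := hv μ (by have := hS μ hμ; omega)
    rw [hz, eval_sum_FF d _ hS c μ (hS μ hμ).le, if_pos hμ] at h1
    rw [(mul_eq_zero.1 h1).resolve_right (FF_good μ).nv, C_0, zero_mul]

lemma interp {n : ℕ} (d : ℕ) (S : Finset (Fin n → ℕ)) (hS : ∀ μ ∈ S, csize μ = d)
    (g : MvPolynomial (Fin n) K) (hg : ∀ ρ, cf g ρ ≠ 0 → csize ρ ≤ d)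
    (hv : ∀ ν, csize ν ≤ d → ν ∉ S → eval (evalPt ν) g = 0) :
    ∃ c : (Fin n → ℕ) → K, g = ∑ μ ∈ S, C (c μ) * FF μ := by
  refine ⟨fun μ => eval (evalPt μ) g / eval (evalPt μ) (FF μ), ?_⟩
  rw [← sub_eq_zero]
  apply vanish_zero (d + 1)
  · intro ρ hρ
    rw [Nat.lt_succ_iff]
    by_contra hlt
    apply hρ
    rw [cf_sub]
    have e1 : cf g ρ = 0 := by
      by_contra hne
      exact hlt (hg ρ hne)
    rw [e1, zero_sub, neg_eq_zero]
    by_contra hne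
    exact hlt (cf_sum_FF_deg d _ hS _ ρ hne)
  · intro ν hν
    rw [map_sub, eval_sum_FF d S hS _ ν (by omega)]
    split_ifs with h
    · rw [div_mul_cancel₀ _ (FF_good ν).nv, sub_self]
    · rw [hv ν (by omega) h, sub_zero]

lemma deg_iff {n : ℕ} (f : MvPolynomial (Fin n) K) (d : ℕ) :
    f.totalDegree ≤ d ↔ ∀ ρ, cf f ρ ≠ 0 → csize ρ ≤ d := by
  have hs : ∀ u : Fin n →₀ ℕ, (u.sum fun _ e => e) = csize ⇑u := fun u =>
    Finsupp.sum_fintype u _ (fun _ => rfl)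
  constructor
  · intro h ρ hρ
    have h1 := le_totalDegree (p := f) (s := expOf ρ) (mem_support_iff.2 hρ)
    rw [hs] at h1
    exact le_trans h1 h
  · intro h
    unfold totalDegree
    apply Finset.sup_le
    intro u hu
    rw [hs]
    apply h
    rw [cf, expOf_coe]
    exact mem_support_iff.1 hu

lemma Estar_spec {n : ℕ} (l : Fin n → ℕ) : IsEstar l (Estar l) := by
  have hex : ∃ f, IsEstar l f := by
    have hG := FF_good l
    refine ⟨C (cf (FF l) l)⁻¹ * FF l, ?_, ?_, ?_⟩
    · rw [deg_iff]
      intro ρ hρ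
      rw [cf, coeff_C_mul] at hρ
      exact hG.deg ρ (right_ne_zero_of_mul hρ)
    · rw [coeff_C_mul]
      exact inv_mul_cancel₀ hG.lead
    · intro ν h1 h2
      rw [map_mul, hG.van ν h1 h2, mul_zero]
  unfold Estar
  rw [dif_pos hex]
  exact hex.choose_spec

lemma Estar_top {n : ℕ} (l ρ : Fin n → ℕ) (h : cf (Estar l) ρ ≠ 0) (hs : csize ρ = csize l) :
    CLe ρ l := by
  obtain ⟨h1, h2, h3⟩ := Estar_spec l
  obtain ⟨c, hc⟩ := interp (csize l) {l} (by simp) (Estar l) ((deg_iff _ _).1 h1)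
    (fun ν h4 h5 => h3 ν h4 (by simpa using h5))
  rw [Finset.sum_singleton] at hc
  rw [hc, cf, coeff_C_mul] at h
  exact (FF_good l).top ρ (right_ne_zero_of_mul h) hs

/-- The invariant of the main induction. -/
structure QQ {n : ℕ} (l κ : Fin n → ℕ) (f : MvPolynomial (Fin n) K) : Prop where
  deg : ∀ ρ, cf f ρ ≠ 0 → csize ρ ≤ csize l
  top : ∀ ρ, cf f ρ ≠ 0 → csize ρ = csize l → ∀ m, NN m n ρ ≤ NN m n l
  van : ∀ ν, csize ν ≤ csize l → ν ∉ Sn l → eval (evalPt ν) f = 0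
  coef : ∀ τ ∈ Sn l, cf f τ = if τ = κ then 1 else 0

lemma QQ_zero {n : ℕ} {l : Fin n → ℕ} (hl : IsPartition l) : QQ l l (Estar l) := by
  obtain ⟨h1, h2, h3⟩ := Estar_spec l
  refine ⟨(deg_iff _ _).1 h1, fun ρ hρ hs m => (Estar_top l ρ hρ hs).2 m n,
    fun ν h4 h5 => h3 ν h4 (fun hc => h5 (hc ▸ mem_Sn_self l)), ?_⟩
  intro τ hτ
  split_ifs with h
  · rw [h]; exact h2
  · by_contra hc
    exact h ((Estar_top l τ hc (csize_Sn hτ)).antisymm (partition_cle hl τ hτ))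

lemma QQ_step {n : ℕ} {l : Fin n → ℕ} (κ : Fin n → ℕ) (f : MvPolynomial (Fin n) K)
    (i : {i : ℕ // i + 1 < n}) (hκ : κ ∈ Sn l) (hlt : κ (hi i) < κ (lo i)) (h : QQ l κ f) :
    QQ l (sw i κ) (heckeAt i f) := by
  have hi2 := i.2
  refine ⟨?_, ?_, ?_, ?_⟩
  · intro τ hτ
    obtain ⟨ρ, h1, h2⟩ := hecke_supp i f τ hτ
    rw [h2.csize]
    exact h.deg ρ h1
  · intro τ hτ hs m
    obtain ⟨ρ, h1, h2⟩ := hecke_supp i f τ hτ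
    exact (h2.NN_le m n (by omega)).trans (h.top ρ h1 (h2.csize ▸ hs) m)
  · intro ν h1 h2
    apply hecke_eval_zero
    · exact h.van ν h1 h2
    · exact h.van _ (by rw [csize_sw]; exact h1) (fun hc => h2 ((sw_mem_Sn i).1 hc))
  · intro τ hτ
    have hκ1 : cf f κ = 1 := by rw [h.coef κ hκ, if_pos rfl]
    rw [hecke_lead i f κ τ, hκ1, one_mul]
    · split_ifs with he
      · rw [he]; exact hecke_mon_sw i κ hlt
      · by_contra hne
        have hin := hecke_mon_supp i κ τ hne
        rcases hin.eq_or (fun m => by rw [NN_Sn hτ, NN_Sn hκ]) with h1 | h1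
        · apply hne
          rw [h1]; exact hecke_mon_self i κ hlt
        · exact he h1
    · intro ρ hρ hin
      have hs : csize ρ = csize l := by rw [← hin.csize]; exact csize_Sn hτ
      have hmem : ρ ∈ Sn l := by
        rcases hin.eq_or (fun m => by rw [NN_Sn hτ]; exact h.top ρ hρ hs m) with h1 | h1
        · rw [← h1]; exact hτ
        · rw [h1] at hτ; exact (sw_mem_Sn i).1 hτ
      by_contra hne
      rw [h.coef ρ hmem, if_neg hne] at hρ
      exact hρ rfl

lemma fstar_QQ {n : ℕ} {l μ : Fin n → ℕ} (hl : IsPartition l) (hμ : μ ∈ Sn l) :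
    QQ l μ (fstar μ) := by
  have hex : ∃ l, IsPartition l ∧ μ ∈ Sn l := ⟨l, hl, hμ⟩
  have hsort : sortDesc μ = l := by
    unfold sortDesc
    rw [dif_pos hex]
    obtain ⟨h1, h2⟩ := hex.choose_spec
    exact partition_unique hl h1 (Sn_trans hμ (Sn_symm h2))
  unfold fstar
  rw [hsort]
  obtain ⟨w, h1, h2, h3⟩ := Tsigma_spec hl hμ
  rw [h1]
  have := word_induct hl (QQ l) (Estar l) (QQ_zero hl) QQ_step w (by rw [h2]; exact h3)
  rwa [h2] at this

lemma mem_SnFinset {n : ℕ} (l μ : Fin n → ℕ) : μ ∈ SnFinset l ↔ μ ∈ Sn l := by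
  simp [SnFinset, Sn]

lemma final_zero {n : ℕ} (l : Fin n → ℕ) (h : MvPolynomial (Fin n) K)
    (h1 : ∀ ρ, cf h ρ ≠ 0 → csize ρ ≤ csize l)
    (h2 : ∀ ν, csize ν ≤ csize l → ν ∉ Sn l → eval (evalPt ν) h = 0)
    (h3 : ∀ τ ∈ Sn l, cf h τ = 0) : h = 0 := by
  have hS : ∀ μ ∈ SnFinset l, csize μ = csize l := fun μ hμ => csize_Sn ((mem_SnFinset l μ).1 hμ)
  obtain ⟨c, hc⟩ := interp (csize l) (SnFinset l) hS h h1
    (fun ν h4 h5 => h2 ν h4 (fun hm => h5 ((mem_SnFinset l ν).2 hm)))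
  have h0 := indep_FF (csize l) (SnFinset l) hS c (by
    intro τ hτ
    rw [← cf_sum_FF, ← hc]
    exact h3 τ ((mem_SnFinset l τ).1 hτ))
  rw [hc]
  apply Finset.sum_eq_zero
  intro μ hμ
  rw [h0 μ hμ, C_0, zero_mul]


/-- characterization of the interpolation ASEP polynomials by
vanishing conditions. -/
theorem statement9 (n : ℕ) (l : Fin n → ℕ) (hl : IsPartition l)
    (μ : Fin n → ℕ) (hμ : μ ∈ Sn l) :
    ((fstar μ).totalDegree ≤ csize μ ∧
      (∀ ν : Fin n → ℕ, csize ν ≤ csize μ → ν ∉ Sn l → eval (evalPt ν) (fstar μ) = 0) ∧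
      (∀ τ ∈ Sn l, coeff (expOf τ) (fstar μ) = if τ = μ then 1 else 0)) ∧
    ∀ g : MvPolynomial (Fin n) K,
      (g.totalDegree ≤ csize μ ∧
        (∀ ν : Fin n → ℕ, csize ν ≤ csize μ → ν ∉ Sn l → eval (evalPt ν) g = 0) ∧
        (∀ τ ∈ Sn l, coeff (expOf τ) g = if τ = μ then 1 else 0)) →
      g = fstar μ := by
  have hF := fstar_QQ hl hμ
  have hsz := csize_Sn hμ
  refine ⟨⟨?_, ?_, ?_⟩, ?_⟩
  · rw [hsz, deg_iff]; exact hF.deg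
  · rw [hsz]; exact hF.van
  · exact hF.coef
  · rintro g ⟨h1, h2, h3⟩
    rw [hsz] at h1 h2
    rw [← sub_eq_zero]
    apply final_zero l
    · apply (deg_iff _ _).1
      exact (totalDegree_sub _ _).trans (max_le h1 ((deg_iff _ _).2 hF.deg))
    · intro ν h4 h5
      rw [map_sub, h2 ν h4 h5, hF.van ν h4 h5, sub_zero]
    · intro τ hτ
      rw [cf_sub, hF.coef τ hτ, ← h3 τ hτ, cf, sub_self]
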